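/- arXiv:2511.10373 — 3 statements merged into one kernel-verified Lean document; each statement's English description precedes it below -/
import Mathlib

section
/- Let P ⊆ ℝ^d be a full-dimensional rational polytope, let q be a positive integer such that qP is a lattice polytope, and let v ∈ ℝ^d be a vector with qv ∈ ℤ^d. Then there exists a polynomial h_v*(t) with nonnegative integer coefficients such that, in ℤ⟦t⟧, (1 − t^q)^{d+1} · ∑_{n ≥ 0} |(nP − v) ∩ ℤ^d| · t^n = h_v*(t). -/
open scoped Pointwise

open Filter Topology

/-- The vectors of `J → ℝ` supported in `S`. -/
def coordSubspace {J : Type*} (S : Set J) : Submodule ℝ (J → ℝ) where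
  carrier := {x | ∀ j ∉ S, x j = 0}
  add_mem' := fun ha hb j hj => by simp [ha j hj, hb j hj]
  zero_mem' := fun _ _ => rfl
  smul_mem' := fun c x hx j hj => by simp [hx j hj]

theorem coordSubspace_mono {J : Type*} {S T : Set J} (h : S ⊆ T) :
    coordSubspace S ≤ coordSubspace T := fun _ hx j hj => hx j fun hS => hj (h hS)

theorem finrank_coordSubspace {J : Type*} (S : Finset J) :
    Module.finrank ℝ (coordSubspace (S : Set J)) = S.card := by
  classical
  let e : coordSubspace (S : Set J) ≃ₗ[ℝ] (S → ℝ) :=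
    { toFun := fun x j => x.1 j
      map_add' := fun _ _ => rfl
      map_smul' := fun _ _ => rfl
      invFun := fun y => ⟨fun j => if h : j ∈ S then y ⟨j, h⟩ else 0, fun j hj => by
        simp_all⟩
      left_inv := fun x => by
        ext j
        by_cases h : j ∈ S
        · simp [h]
        · simpa [h] using (x.2 j (by simpa using h)).symm
      right_inv := fun y => by
        ext j
        simp }
  rw [e.finrank_eq]
  simp

section

variable {J V : Type*} [AddCommGroup V] [Module ℝ V]

/-- `R` is a two-sided inverse of the restriction of `U` to the vectors supported in `B`. -/
structure IsCoord (U : (J → ℝ) →ₗ[ℝ] V) (B : Set J) (R : V →ₗ[ℝ] (J → ℝ)) : Prop where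
  mem : ∀ z, R z ∈ coordSubspace B
  right_inv : ∀ z, U (R z) = z
  left_inv : ∀ x ∈ coordSubspace B, R (U x) = x

theorem exists_isCoord {U : (J → ℝ) →ₗ[ℝ] V} {B : Set J}
    (hinj : ∀ x ∈ coordSubspace B, U x = 0 → x = 0)
    (hsurj : (coordSubspace B).map U = ⊤) : ∃ R, IsCoord U B R := by
  have hb : Function.Bijective (U.domRestrict (coordSubspace B)) := by
    constructor
    · rw [← LinearMap.ker_eq_bot, LinearMap.ker_eq_bot']
      intro m hm
      exact Subtype.ext (hinj m.1 m.2 hm)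
    · intro z
      have : z ∈ (coordSubspace B).map U := by rw [hsurj]; trivial
      obtain ⟨x, hx, rfl⟩ := this
      exact ⟨⟨x, hx⟩, rfl⟩
  let e := LinearEquiv.ofBijective _ hb
  refine ⟨(coordSubspace B).subtype ∘ₗ e.symm.toLinearMap, fun z => (e.symm z).2, fun z => ?_, ?_⟩
  · exact e.apply_symm_apply z
  · intro x hx
    have := e.symm_apply_apply ⟨x, hx⟩
    exact congrArg Subtype.val this

theorem IsCoord.card_eq {U : (J → ℝ) →ₗ[ℝ] V} {B : Finset J} {R : V →ₗ[ℝ] (J → ℝ)}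
    (h : IsCoord U (B : Set J) R) : B.card = Module.finrank ℝ V := by
  rw [← finrank_coordSubspace B]
  refine LinearEquiv.finrank_eq
    { toFun := fun x => U x.1
      map_add' := fun x y => by simp
      map_smul' := fun c x => by simp
      invFun := fun z => ⟨R z, h.mem z⟩
      left_inv := fun x => Subtype.ext (h.left_inv x.1 x.2)
      right_inv := h.right_inv }

/-- A vector outside finitely many subspaces pushes any point off them for small times. -/
theorem eventually_add_smul_notMem {ι : Type*} [Finite ι] (W : ι → Submodule ℝ V) (x y : V)
    (hy : ∀ i, y ∉ W i) : ∀ᶠ ε : ℝ in 𝓝[>] 0, ∀ i, x + ε • y ∉ W i := by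
  rw [eventually_all]
  intro i
  have hsub : {ε : ℝ | x + ε • y ∈ W i}.Subsingleton := by
    intro a ha b hb
    by_contra hab
    apply hy i
    have h1 : (a - b) • y ∈ W i := by
      have := (W i).sub_mem ha hb
      convert this using 1
      module
    exact ((W i).smul_mem_iff (sub_ne_zero.2 hab)).1 h1
  have h2 : {ε : ℝ | x + ε • y ∈ W i}ᶜ ∪ {0} ∈ 𝓝 (0 : ℝ) := by
    have hf : ({ε : ℝ | x + ε • y ∈ W i} \ {0}).Finite := hsub.finite.subset Set.sdiff_subset
    have : ({ε : ℝ | x + ε • y ∈ W i} \ {0})ᶜ ∈ 𝓝 (0 : ℝ) :=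
      hf.isClosed.isOpen_compl.mem_nhds (by simp)
    filter_upwards [this] with ε hε
    simp at hε ⊢
    tauto
  filter_upwards [mem_nhdsWithin_of_mem_nhds h2, self_mem_nhdsWithin] with ε hε hpos
  rcases hε with hε | hε
  · exact hε
  · exact absurd hε (ne_of_gt hpos)

/-- The cone spanned by a spanning family has a point in general position. -/
theorem exists_generic_nonneg [Finite J] (U : (J → ℝ) →ₗ[ℝ] V) (hU : Function.Surjective U) :
    ∃ θ : J → ℝ, 0 ≤ θ ∧
      ∀ S : Set J, (coordSubspace S).map U ≠ ⊤ → U θ ∉ (coordSubspace S).map U := by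
  have := Fintype.ofFinite J
  let ι := {S : Set J // (coordSubspace S).map U ≠ ⊤}
  let W : ι → Submodule ℝ (J → ℝ) := fun S => ((coordSubspace S.1).map U).comap U
  have hW : ∀ i, W i ≠ ⊤ := by
    intro i hi
    apply i.2
    rw [eq_top_iff]
    intro z _
    obtain ⟨x, rfl⟩ := hU z
    have : x ∈ W i := by rw [hi]; trivial
    exact this
  obtain ⟨y, hy⟩ := Submodule.exists_forall_notMem_of_forall_ne_top W hW
  have h1 := eventually_add_smul_notMem W 1 y hy
  have h2 : ∀ᶠ ε : ℝ in 𝓝[>] 0, ∀ j, 0 < (1 + ε • y) j := by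
    rw [eventually_all]
    intro j
    apply mem_nhdsWithin_of_mem_nhds
    have hc : Continuous fun ε : ℝ => (1 + ε • y) j := by
      simp only [Pi.add_apply, Pi.smul_apply]; fun_prop
    exact (isOpen_lt continuous_const hc).mem_nhds (by simp)
  obtain ⟨ε, h1, h2⟩ := (h1.and h2).exists
  exact ⟨1 + ε • y, fun j => (h2 j).le, fun S hS => h1 ⟨S, hS⟩⟩

/-- A cost functional that vanishes on no chosen linear relation. -/
theorem exists_generic_cost [Finite J] (U : (J → ℝ) →ₗ[ℝ] V) :
    ∃ c : (J → ℝ) →ₗ[ℝ] ℝ, ∀ S : Set J, (∃ x ∈ coordSubspace S, U x = 0 ∧ x ≠ 0) →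
      ∃ x ∈ coordSubspace S, U x = 0 ∧ c x ≠ 0 := by
  let ι := {S : Set J // ∃ x ∈ coordSubspace S, U x = 0 ∧ x ≠ 0}
  choose κ h1 h2 h3 using fun S : ι => S.2
  obtain ⟨c, hc⟩ := Module.exists_dual_forall_apply_ne_zero (K := ℝ) κ h3
  exact ⟨c, fun S hS => ⟨κ ⟨S, hS⟩, h1 ⟨S, hS⟩, h2 _, hc _⟩⟩

/-- `B` is a strictly dual feasible basis for the cost `c`. -/
def IsDualFeasible (U : (J → ℝ) →ₗ[ℝ] V) (c : (J → ℝ) →ₗ[ℝ] ℝ) (B : Set J) : Prop :=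
  ∃ R, IsCoord U B R ∧ ∀ x, 0 ≤ x → x ∉ coordSubspace B → c (R (U x)) < c x

theorem IsDualFeasible.eq_of_pos {U : (J → ℝ) →ₗ[ℝ] V} {c : (J → ℝ) →ₗ[ℝ] ℝ} {B B' : Set J}
    (hB : IsDualFeasible U c B) (hB' : IsDualFeasible U c B') {x x' : J → ℝ}
    (hx : x ∈ coordSubspace B) (hx' : x' ∈ coordSubspace B')
    (hpos : ∀ j ∈ B, 0 < x j) (hpos' : ∀ j ∈ B', 0 < x' j) (hU : U x = U x') : B = B' := by
  obtain ⟨R, hR, hc⟩ := hB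
  obtain ⟨R', hR', hc'⟩ := hB'
  have nonneg : ∀ {S : Set J} {w : J → ℝ}, w ∈ coordSubspace S → (∀ j ∈ S, 0 < w j) → 0 ≤ w := by
    intro S w hw hp j
    by_cases hj : j ∈ S
    · exact (hp j hj).le
    · exact (hw j hj).ge
  have sub : ∀ {S S' : Set J} {w : J → ℝ}, w ∈ coordSubspace S' → (∀ j ∈ S, 0 < w j) →
      S ⊆ S' := by
    intro S S' w hw hp j hj
    by_contra h
    exact (hp j hj).ne' (hw j h)
  by_cases h1 : x' ∈ coordSubspace B
  · by_cases h2 : x ∈ coordSubspace B'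
    · exact (sub h2 hpos).antisymm (sub h1 hpos')
    · have e1 := hc' x (nonneg hx hpos) h2
      rw [hU, hR'.left_inv x' hx', ← hR.left_inv x' h1, ← hU, hR.left_inv x hx] at e1
      exact absurd e1 (lt_irrefl _)
  · have e1 := hc x' (nonneg hx' hpos') h1
    rw [← hU, hR.left_inv x hx] at e1
    by_cases h2 : x ∈ coordSubspace B'
    · rw [← hR'.left_inv x h2, hU, hR'.left_inv x' hx'] at e1
      exact absurd e1 (lt_irrefl _)
    · have e2 := hc' x (nonneg hx hpos) h2
      rw [hU, hR'.left_inv x' hx'] at e2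
      exact absurd (e1.trans e2) (lt_irrefl _)

theorem nonneg_of_isMinOn [Finite J] {U : (J → ℝ) →ₗ[ℝ] V} {c : (J → ℝ) →ₗ[ℝ] ℝ} {x κ : J → ℝ}
    (hx : 0 ≤ x) (hmin : ∀ y, 0 ≤ y → U y = U x → c x ≤ c y) (hκ : U κ = 0)
    (hκx : ∀ j, x j = 0 → 0 ≤ κ j) : 0 ≤ c κ := by
  have h2 : ∀ᶠ ε : ℝ in 𝓝[>] 0, ∀ j, 0 ≤ (x + ε • κ) j := by
    rw [eventually_all]
    intro j
    rcases (hx j).eq_or_lt with h | h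
    · filter_upwards [self_mem_nhdsWithin] with ε hε
      have := mul_nonneg (le_of_lt hε) (hκx j h.symm)
      simpa [← h] using this
    · apply mem_nhdsWithin_of_mem_nhds
      have hc : Continuous fun ε : ℝ => (x + ε • κ) j := by
        simp only [Pi.add_apply, Pi.smul_apply]; fun_prop
      filter_upwards [(isOpen_lt continuous_const hc).mem_nhds
        (show (0 : ℝ) < (x + (0 : ℝ) • κ) j by simpa using h)] with ε hε
      exact le_of_lt hε
  obtain ⟨ε, h1, h2⟩ := (h2.and self_mem_nhdsWithin).exists
  have := hmin (x + ε • κ) h1 (by simp [hκ])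
  rw [map_add, map_smul, le_add_iff_nonneg_right] at this
  exact nonneg_of_mul_nonneg_right this h2

theorem exists_isMinOn [Fintype J] (U : (J → ℝ) →ₗ[ℝ] V) (c : (J → ℝ) →ₗ[ℝ] ℝ)
    (ℓ : V →ₗ[ℝ] ℝ) (hℓ : ∀ x, ℓ (U x) = ∑ j, x j) (x₀ : J → ℝ) (hx₀ : 0 ≤ x₀) :
    ∃ x, 0 ≤ x ∧ U x = U x₀ ∧ ∀ y, 0 ≤ y → U y = U x₀ → c x ≤ c y := by
  let K : Set (J → ℝ) := {x | 0 ≤ x ∧ U x = U x₀}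
  have hK : IsCompact K := by
    refine (isCompact_Icc (a := (0 : J → ℝ)) (b := fun _ => ∑ j, x₀ j)).of_isClosed_subset ?_ ?_
    · have h1 : IsClosed {x : J → ℝ | 0 ≤ x} := isClosed_Ici
      have h2 : IsClosed ((fun x : J → ℝ => x - x₀) ⁻¹' (LinearMap.ker U : Set (J → ℝ))) :=
        (Submodule.closed_of_finiteDimensional _).preimage (by fun_prop)
      convert h1.inter h2 using 1
      ext x
      simp [K, sub_eq_zero]
    · rintro x ⟨hx, hU⟩
      refine ⟨hx, fun j => ?_⟩
      rw [← hℓ, ← hU, hℓ]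
      exact Finset.single_le_sum (fun i _ => hx i) (Finset.mem_univ j)
  obtain ⟨x, hx, hmin⟩ := hK.exists_isMinOn ⟨x₀, hx₀, rfl⟩
    (c.continuous_of_finiteDimensional.continuousOn)
  exact ⟨x, hx.1, hx.2, fun y h1 h2 => hmin ⟨h1, h2⟩⟩

theorem exists_isDualFeasible [Fintype J] (U : (J → ℝ) →ₗ[ℝ] V) (c : (J → ℝ) →ₗ[ℝ] ℝ)
    (hc : ∀ S : Set J, (∃ x ∈ coordSubspace S, U x = 0 ∧ x ≠ 0) →
      ∃ x ∈ coordSubspace S, U x = 0 ∧ c x ≠ 0)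
    (ℓ : V →ₗ[ℝ] ℝ) (hℓ : ∀ x, ℓ (U x) = ∑ j, x j) (x₀ : J → ℝ) (hx₀ : 0 ≤ x₀)
    (hgen : ∀ S : Set J, (coordSubspace S).map U ≠ ⊤ → U x₀ ∉ (coordSubspace S).map U) :
    ∃ B, IsDualFeasible U c B ∧
      ∃ x ∈ coordSubspace B, U x = U x₀ ∧ ∀ j ∈ B, 0 < x j := by
  classical
  obtain ⟨x, hx, hUx, hmin⟩ := exists_isMinOn U c ℓ hℓ x₀ hx₀
  have hmove : ∀ κ : J → ℝ, U κ = 0 → (∀ j, x j = 0 → 0 ≤ κ j) → 0 ≤ c κ := fun κ =>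
    nonneg_of_isMinOn hx (fun y h1 h2 => hmin y h1 (h2.trans hUx))
  let B : Set J := {j | x j ≠ 0}
  have hxB : x ∈ coordSubspace B := fun j hj => by simpa [B] using hj
  have hinj : ∀ κ ∈ coordSubspace B, U κ = 0 → κ = 0 := by
    by_contra! h
    obtain ⟨κ, hκB, hκ, hcκ⟩ := hc B h
    have h1 := hmove κ hκ fun j hj => (hκB j (by simpa [B] using hj)).ge
    have h2 := hmove (-κ) (by simp [hκ]) fun j hj => by
      simp [hκB j (by simpa [B] using hj)]
    rw [map_neg] at h2
    exact hcκ (le_antisymm (by linarith) h1)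
  have hsurj : (coordSubspace B).map U = ⊤ := by
    by_contra h
    exact hgen B h ⟨x, hxB, hUx⟩
  obtain ⟨R, hR⟩ := exists_isCoord hinj hsurj
  let κ : J → J → ℝ := fun j => Pi.single j 1 - R (U (Pi.single j 1))
  have hUκ : ∀ j, U (κ j) = 0 := fun j => by simp [κ, hR.right_inv]
  have hκ_off : ∀ j, ∀ i ∉ B, κ j i = (Pi.single j 1 : J → ℝ) i := fun j i hi => by
    simp [κ, hR.mem _ i hi]
  have hκ_zero : ∀ j ∈ B, κ j = 0 := fun j hj => by
    have : (Pi.single j 1 : J → ℝ) ∈ coordSubspace B := fun i hi => by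
      rw [Pi.single_eq_of_ne]
      rintro rfl
      exact hi hj
    simp [κ, hR.left_inv _ this]
  have hκ_pos : ∀ j ∉ B, 0 < c (κ j) := by
    intro j hj
    have hnn : 0 ≤ c (κ j) := hmove _ (hUκ j) fun i hi => by
      rw [hκ_off j i (by simpa [B] using hi)]
      by_cases h : i = j
      · subst h; simp
      · simp [h]
    have hκj : κ j ∈ coordSubspace (insert j B) := fun i hi => by
      rw [Set.mem_insert_iff, not_or] at hi
      rw [hκ_off j i hi.2, Pi.single_eq_of_ne hi.1]
    have hκjj : κ j j = 1 := by simp [hκ_off j j hj]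
    obtain ⟨w, hw, hUw, hcw⟩ := hc (insert j B) ⟨κ j, hκj, hUκ j, fun h => by
      rw [h] at hκjj; simp at hκjj⟩
    have hw' : w - w j • κ j = 0 := by
      refine hinj _ (fun i hi => ?_) (by simp [hUw, hUκ])
      by_cases h : i = j
      · subst h; simp [hκjj]
      · have hi' : i ∉ insert j B := by simp [h, hi]
        simp [hw i hi', hκj i hi']
    rw [sub_eq_zero] at hw'
    refine hnn.lt_of_ne fun h => hcw ?_
    rw [hw', map_smul, ← h, smul_zero]
  refine ⟨B, ⟨R, hR, fun y hy hyB => ?_⟩, x, hxB, hUx, fun j hj => (hx j).lt_of_ne' hj⟩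
  have hdecomp : y - R (U y) = ∑ j, y j • κ j := by
    have h1 : y = ∑ j, y j • (Pi.single j 1 : J → ℝ) := by
      ext i; simp [Finset.sum_apply, Pi.single_apply]
    conv_lhs => rw [h1]
    simp [κ, smul_sub, Finset.sum_sub_distrib]
  have hpos : 0 < c (y - R (U y)) := by
    rw [hdecomp, map_sum]
    obtain ⟨j, hj, hyj⟩ : ∃ j, j ∉ B ∧ y j ≠ 0 := by
      by_contra! h
      exact hyB h
    refine Finset.sum_pos' (fun i _ => ?_) ⟨j, Finset.mem_univ j, ?_⟩
    · rw [map_smul]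
      by_cases hi : i ∈ B
      · simp [hκ_zero i hi]
      · exact mul_nonneg (hy i) (hκ_pos i hi).le
    · rw [map_smul]
      exact mul_pos ((hy j).lt_of_ne' hyj) (hκ_pos j hj)
  rw [map_sub] at hpos
  linarith

/-- A cone over a polytope is partitioned into half-open simplicial cones on its generators. -/
theorem exists_halfOpen_decomposition [Fintype J] (U : (J → ℝ) →ₗ[ℝ] V)
    (hU : Function.Surjective U) (ℓ : V →ₗ[ℝ] ℝ) (hℓ : ∀ x, ℓ (U x) = ∑ j, x j) :
    ∃ (T : Set (Finset J)) (O : Finset J → Set J),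
      (∀ B ∈ T, B.card = Module.finrank ℝ V) ∧
      ∀ x₀ : J → ℝ, 0 ≤ x₀ → ∃! p : Finset J × (J → ℝ), p.1 ∈ T ∧
        p.2 ∈ coordSubspace (p.1 : Set J) ∧ U p.2 = U x₀ ∧
        ∀ j ∈ p.1, 0 ≤ p.2 j ∧ (j ∈ O p.1 → 0 < p.2 j) := by
  classical
  obtain ⟨c, hc⟩ := exists_generic_cost U
  obtain ⟨θ, hθ, hgen⟩ := exists_generic_nonneg U hU
  let T : Set (Finset J) := {B | IsDualFeasible U c (B : Set J)}
  choose! R hR hRc using fun (B : Finset J) (hB : B ∈ T) => hB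
  have hne : ∀ B ∈ T, ∀ j ∈ B, R B (U θ) j ≠ 0 := by
    intro B hB j hj h
    have hmem : R B (U θ) ∈ coordSubspace ((B.erase j : Finset J) : Set J) := by
      intro i hi
      by_cases hij : i = j
      · rw [hij, h]
      · exact (hR B hB).mem _ i (by simpa [hij] using hi)
    refine hgen _ (fun htop => ?_) ⟨_, hmem, (hR B hB).right_inv _⟩
    have hinj : ∀ x ∈ coordSubspace ((B.erase j : Finset J) : Set J), U x = 0 → x = 0 := by
      intro x hx hx0
      rw [← (hR B hB).left_inv x (coordSubspace_mono (by simp) hx), hx0, map_zero]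
    obtain ⟨R', hR'⟩ := exists_isCoord hinj htop
    have h1 := hR'.card_eq
    rw [← (hR B hB).card_eq] at h1
    exact (Finset.card_erase_lt_of_mem hj).ne h1
  refine ⟨T, fun B => {j | R B (U θ) j < 0}, fun B hB => (hR B hB).card_eq, fun x₀ hx₀ => ?_⟩
  have hcont : ∀ (a b : ℝ), 0 < a → ∀ᶠ ε : ℝ in 𝓝[>] 0, 0 < a + ε * b := by
    intro a b ha
    apply mem_nhdsWithin_of_mem_nhds
    exact (isOpen_lt continuous_const (by fun_prop)).mem_nhds (by simpa using ha)
  have hpush : ∀ p : Finset J × (J → ℝ), p.1 ∈ T →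
      (∀ j ∈ p.1, 0 ≤ p.2 j ∧ (j ∈ {j | R p.1 (U θ) j < 0} → 0 < p.2 j)) →
      ∀ᶠ ε : ℝ in 𝓝[>] 0, ∀ j ∈ p.1, 0 < (p.2 + ε • R p.1 (U θ)) j := by
    rintro ⟨B, x⟩ hB hx
    simp only at hB hx ⊢
    rw [Filter.eventually_all_finset]
    intro j hj
    rcases (hx j hj).1.eq_or_lt with h | h
    · have hθj : 0 < R B (U θ) j := (not_lt.1 fun hO => ((hx j hj).2 hO).ne h).lt_of_ne'
        (hne B hB j hj)
      filter_upwards [self_mem_nhdsWithin] with ε hε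
      simpa [← h] using mul_pos hε hθj
    · exact hcont _ _ h
  have hgen' := eventually_add_smul_notMem
    (fun S : {S : Set J // (coordSubspace S).map U ≠ ⊤} => (coordSubspace S.1).map U) (U x₀) (U θ)
    fun S => hgen S.1 S.2
  have hex : ∀ᶠ ε : ℝ in 𝓝[>] 0, ∃ B ∈ T, ∀ j ∈ B, 0 < (R B (U x₀) + ε • R B (U θ)) j := by
    filter_upwards [hgen', self_mem_nhdsWithin] with ε hε hpos
    obtain ⟨B, hB, x, hxB, hUx, hxpos⟩ := exists_isDualFeasible U c hc ℓ hℓ (x₀ + ε • θ)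
      (add_nonneg hx₀ (smul_nonneg (le_of_lt hpos) hθ)) fun S hS => by
        simpa using hε ⟨S, hS⟩
    have hBT : B.toFinset ∈ T := by simpa [T] using hB
    refine ⟨B.toFinset, hBT, fun j hj => ?_⟩
    rw [← map_smul, ← map_add, ← map_smul, ← map_add, ← hUx,
      (hR _ hBT).left_inv x (by simpa using hxB)]
    exact hxpos j (by simpa using hj)
  obtain ⟨B, hB⟩ : ∃ B, ∃ᶠ ε : ℝ in 𝓝[>] 0,
      B ∈ T ∧ ∀ j ∈ B, 0 < (R B (U x₀) + ε • R B (U θ)) j := by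
    by_contra h
    simp only [not_exists, not_frequently] at h
    obtain ⟨ε, h1, B, h2⟩ := ((eventually_all.2 h).and hex).exists
    exact h1 B h2
  have hBT : B ∈ T := hB.exists.choose_spec.1
  refine ⟨(B, R B (U x₀)), ⟨hBT, (hR B hBT).mem _, (hR B hBT).right_inv _, fun j hj => ?_⟩, ?_⟩
  · have hpos : ∃ᶠ ε : ℝ in 𝓝[>] 0, 0 < R B (U x₀) j + ε * R B (U θ) j :=
      hB.mono fun ε h => h.2 j hj
    constructor
    · by_contra! hneg
      obtain ⟨ε, h1, h2⟩ := (hpos.and_eventually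
        (hcont (-R B (U x₀) j) (-R B (U θ) j) (by linarith))).exists
      linarith
    · intro hO
      obtain ⟨ε, h1, h2⟩ := (hpos.and_eventually self_mem_nhdsWithin).exists
      have := mul_neg_of_pos_of_neg h2 hO
      simp only at this ⊢
      linarith
  · rintro ⟨B', x'⟩ ⟨hB', hx', hUx', hcond⟩
    simp only at hB' hx' hUx' hcond
    obtain ⟨ε, h1, h2⟩ := (hB.and_eventually (hpush (B', x') hB' hcond)).exists
    have hBB : (B : Set J) = B' := by
      refine IsDualFeasible.eq_of_pos (U := U) (c := c) hBT hB'
        (Submodule.add_mem _ ((hR B hBT).mem (U x₀)) (Submodule.smul_mem _ ε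
          ((hR B hBT).mem (U θ))))
        (Submodule.add_mem _ hx' (Submodule.smul_mem _ ε ((hR B' hB').mem (U θ)))) h1.2 h2 ?_
      simp [(hR B hBT).right_inv, (hR B' hB').right_inv, hUx']
    have hBB' : B = B' := by exact_mod_cast hBB
    subst hBB'
    rw [← hUx', (hR B hBT).left_inv x' hx']

end

section

variable {J : Type*} [Fintype J]

theorem finite_supported_weight_eq (S : Finset J) {q : ℕ} (hq : 0 < q) (h n : ℕ) :
    {k : J → ℕ | (∀ j ∉ S, k j = 0) ∧ h + q * ∑ j, k j = n}.Finite := by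
  classical
  refine (Set.finite_Icc 0 (fun _ : J => n)).subset ?_
  rintro k ⟨-, hk⟩
  refine ⟨fun j => Nat.zero_le _, fun j => ?_⟩
  have h1 : k j ≤ ∑ j, k j := Finset.single_le_sum (fun _ _ => Nat.zero_le _) (Finset.mem_univ j)
  have h2 : ∑ j, k j ≤ q * ∑ j, k j := Nat.le_mul_of_pos_left _ hq
  change k j ≤ n
  omega

/-- The generating function of a coordinate orthant whose generators have weight `q`. -/
theorem one_sub_X_pow_mul_orthant_series (S : Finset J) {q : ℕ} (hq : 0 < q) (h : ℕ) :
    (1 - PowerSeries.X ^ q) ^ S.card * PowerSeries.mk (fun n =>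
      ({k : J → ℕ | (∀ j ∉ S, k j = 0) ∧ h + q * ∑ j, k j = n}.ncard : ℤ)) =
      PowerSeries.X ^ h := by
  classical
  induction S using Finset.induction_on with
  | empty =>
    ext n
    simp only [Finset.card_empty, pow_zero, one_mul, PowerSeries.coeff_mk, PowerSeries.coeff_X_pow]
    split_ifs with hn
    · have : {k : J → ℕ | (∀ j ∉ (∅ : Finset J), k j = 0) ∧ h + q * ∑ j, k j = n} = {0} := by
        ext k
        simp only [Finset.notMem_empty, not_false_eq_true, forall_true_left, Set.mem_ofPred_eq,
          Set.mem_singleton_iff]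
        constructor
        · exact fun hk => funext hk.1
        · rintro rfl
          simp [hn]
      rw [this]
      simp
    · have : {k : J → ℕ | (∀ j ∉ (∅ : Finset J), k j = 0) ∧ h + q * ∑ j, k j = n} = ∅ := by
        ext k
        simp only [Finset.notMem_empty, not_false_eq_true, forall_true_left, Set.mem_ofPred_eq,
          Set.mem_empty_iff_false, iff_false, not_and]
        intro hk
        have : k = 0 := funext hk
        simpa [this] using fun h' => hn h'.symm
      rw [this]
      simp
  | insert a S ha ih =>
    rw [Finset.card_insert_of_notMem ha, pow_succ, mul_assoc]
    rw [← ih]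
    congr 1
    ext n
    rw [sub_mul, one_mul, map_sub, PowerSeries.coeff_X_pow_mul', sub_eq_iff_eq_add]
    simp only [PowerSeries.coeff_mk]
    let F : ℕ → Set (J → ℕ) := fun n =>
      {k : J → ℕ | (∀ j ∉ insert a S, k j = 0) ∧ h + q * ∑ j, k j = n}
    let G : Set (J → ℕ) := {k : J → ℕ | (∀ j ∉ S, k j = 0) ∧ h + q * ∑ j, k j = n}
    have hsum : ∀ k : J → ℕ, ∑ j, (k + Pi.single a 1 : J → ℕ) j = ∑ j, k j + 1 := fun k => by
      simp [Finset.sum_add_distrib]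
    have hGF : G = {k ∈ F n | k a = 0} := by
      ext k
      simp only [F, G, Set.mem_ofPred_eq, Finset.mem_insert, not_or]
      constructor
      · rintro ⟨h1, h2⟩
        exact ⟨⟨fun j hj => h1 j hj.2, h2⟩, h1 a ha⟩
      · rintro ⟨⟨h1, h2⟩, h3⟩
        refine ⟨fun j hj => ?_, h2⟩
        by_cases hja : j = a
        · rw [hja, h3]
        · exact h1 j ⟨hja, hj⟩
    have hshift : {k ∈ F n | ¬ k a = 0} =
        if q ≤ n then (· + Pi.single a 1) '' F (n - q) else ∅ := by
      ext k
      have hback : k a ≠ 0 → (k - Pi.single a 1) + Pi.single a 1 = k := by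
        intro hk
        ext j
        by_cases hja : j = a
        · subst hja
          simp
          omega
        · simp [hja]
      split_ifs with hn
      · constructor
        · rintro ⟨⟨h1, h2⟩, h3⟩
          refine ⟨k - Pi.single a 1, ⟨fun j hj => by simp [h1 j hj], ?_⟩, hback h3⟩
          have := hsum (k - Pi.single a 1)
          rw [hback h3] at this
          rw [this, mul_add] at h2
          omega
        · rintro ⟨k, ⟨h1, h2⟩, rfl⟩
          refine ⟨⟨fun j hj => ?_, ?_⟩, by simp⟩
          · have : j ≠ a := fun h => hj (by simp [h])
            simp [h1 j hj, this]
          · simp only [hsum, mul_add]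
            omega
      · simp only [Set.mem_empty_iff_false, iff_false]
        rintro ⟨⟨h1, h2⟩, h3⟩
        have := hsum (k - Pi.single a 1)
        rw [hback h3] at this
        rw [this, mul_add] at h2
        omega
    have hfin : (F n).Finite := finite_supported_weight_eq _ hq h n
    have hcard : (F n).ncard = G.ncard + {k ∈ F n | ¬ k a = 0}.ncard := by
      rw [hGF, ← Set.ncard_union_eq ?_ (hfin.subset fun k hk => hk.1)
        (hfin.subset fun k hk => hk.1)]
      · congr 1
        ext k
        simp only [Set.mem_union, Set.mem_ofPred_eq]
        tauto
      · rw [Set.disjoint_left]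
        rintro k ⟨-, h1⟩ ⟨-, h2⟩
        exact h2 h1
    change ((F n).ncard : ℤ) = (G.ncard : ℤ) + if q ≤ n then ((F (n - q)).ncard : ℤ) else 0
    rw [hcard, hshift]
    split_ifs with hn
    · rw [Set.ncard_image_of_injective _ (add_left_injective _)]
      simp
    · simp

theorem one_sub_X_pow_mul_series_of_boxes {β : Type*} [Fintype β] (B : β → Finset J) (h : β → ℕ)
    {q : ℕ} (hq : 0 < q) {m : ℕ} (hm : ∀ p, (B p).card = m) :
    (1 - PowerSeries.X ^ q) ^ m * PowerSeries.mk (fun n =>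
      (Nat.card {x : β × (J → ℕ) //
        (∀ j ∉ B x.1, x.2 j = 0) ∧ h x.1 + q * ∑ j, x.2 j = n} : ℤ)) =
      ∑ p, PowerSeries.X ^ h p := by
  have hcount : ∀ n, Nat.card {x : β × (J → ℕ) //
      (∀ j ∉ B x.1, x.2 j = 0) ∧ h x.1 + q * ∑ j, x.2 j = n} =
      ∑ p, {k : J → ℕ | (∀ j ∉ B p, k j = 0) ∧ h p + q * ∑ j, k j = n}.ncard := by
    intro n
    let e : {x : β × (J → ℕ) // (∀ j ∉ B x.1, x.2 j = 0) ∧ h x.1 + q * ∑ j, x.2 j = n} ≃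
        Σ p, {k : J → ℕ | (∀ j ∉ B p, k j = 0) ∧ h p + q * ∑ j, k j = n} :=
      { toFun := fun x => ⟨x.1.1, x.1.2, x.2⟩
        invFun := fun y => ⟨(y.1, y.2.1), y.2.2⟩
        left_inv := fun _ => rfl
        right_inv := fun _ => rfl }
    have := fun p => (finite_supported_weight_eq (B p) hq (h p) n).to_subtype
    rw [Nat.card_congr e, Nat.card_sigma]
    rfl
  have hseries : PowerSeries.mk (fun n => (Nat.card {x : β × (J → ℕ) //
      (∀ j ∉ B x.1, x.2 j = 0) ∧ h x.1 + q * ∑ j, x.2 j = n} : ℤ)) =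
      ∑ p, PowerSeries.mk (fun n =>
        ({k : J → ℕ | (∀ j ∉ B p, k j = 0) ∧ h p + q * ∑ j, k j = n}.ncard : ℤ)) := by
    ext n
    simp [hcount]
  rw [hseries, Finset.mul_sum]
  refine Finset.sum_congr rfl fun p _ => ?_
  rw [← one_sub_X_pow_mul_orthant_series (B p) hq (h p), hm]

end

/-- Membership in `(0, 1]` if `o` holds and in `[0, 1)` otherwise. -/
def InHalfOpenUnit (o : Prop) (t : ℝ) : Prop :=
  (0 ≤ t ∧ (o → 0 < t)) ∧ t ≤ 1 ∧ (¬o → t < 1)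

theorem exists_nat_sub_inHalfOpenUnit {o : Prop} {t : ℝ} (h : 0 ≤ t ∧ (o → 0 < t)) :
    ∃ k : ℕ, InHalfOpenUnit o (t - k) := by
  by_cases ho : o
  · have ht := h.2 ho
    have h1 : 0 < ⌈t⌉₊ := Nat.ceil_pos.2 ht
    have h2 := Nat.ceil_lt_add_one ht.le
    have h3 := Nat.le_ceil t
    refine ⟨⌈t⌉₊ - 1, ?_⟩
    rw [InHalfOpenUnit, Nat.cast_sub h1]
    push_cast
    exact ⟨⟨by linarith, fun _ => by linarith⟩, by linarith, fun hn => absurd ho hn⟩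
  · have h2 := Nat.lt_floor_add_one t
    have h3 := Nat.floor_le h.1
    exact ⟨⌊t⌋₊, ⟨by linarith, fun h => absurd h ho⟩, by linarith, fun _ => by linarith⟩

theorem InHalfOpenUnit.eq_of_add_eq {o : Prop} {s t : ℝ} {a b : ℕ} (hs : InHalfOpenUnit o s)
    (ht : InHalfOpenUnit o t) (h : s + a = t + b) : a = b := by
  have hlt : s - t < 1 ∧ t - s < 1 := by
    obtain ⟨⟨h1, h2⟩, h3, h4⟩ := hs
    obtain ⟨⟨h1', h2'⟩, h3', h4'⟩ := ht
    by_cases ho : o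
    · have := h2 ho
      have := h2' ho
      constructor <;> linarith
    · have := h4 ho
      have := h4' ho
      constructor <;> linarith
  have h1 : (a : ℝ) < b + 1 := by linarith [hlt.2]
  have h2 : (b : ℝ) < a + 1 := by linarith [hlt.1]
  have h1' : a < b + 1 := by exact_mod_cast h1
  have h2' : b < a + 1 := by exact_mod_cast h2
  omega

section

variable {J : Type*} [Fintype J] {d : ℕ}

/-- The linear map sending the basis vector `j` to `(w j, q)`. -/
noncomputable def coneMap (w : J → Fin d → ℤ) (q : ℕ) : (J → ℝ) →ₗ[ℝ] (Fin d → ℝ) × ℝ :=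
  Fintype.linearCombination ℝ fun j => ((fun i => (w j i : ℝ)), (q : ℝ))

theorem coneMap_apply (w : J → Fin d → ℤ) (q : ℕ) (x : J → ℝ) :
    coneMap w q x = ((fun i => ∑ j, x j * w j i), q * ∑ j, x j) := by
  rw [coneMap, Fintype.linearCombination_apply]
  ext i
  · simp [Prod.fst_sum, Finset.sum_apply]
  · simp [Prod.snd_sum, Finset.sum_mul, mul_comm (q : ℝ)]

theorem coneMap_natCast (w : J → Fin d → ℤ) (q : ℕ) (k : J → ℕ) :
    coneMap w q (fun j => (k j : ℝ)) =
      ((fun i => ((∑ j, (k j : ℤ) * w j i : ℤ) : ℝ)), ((q * ∑ j, k j : ℕ) : ℝ)) := by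
  rw [coneMap_apply]
  push_cast
  rfl

theorem finite_of_bounded_coords {q : ℕ} (w : J → Fin d → ℤ) (v : Fin d → ℝ) :
    {a : (Fin d → ℤ) × ℕ | ∃ x : J → ℝ, 0 ≤ x ∧ x ≤ 1 ∧
      coneMap w q x = ((fun i => (a.1 i : ℝ)) + v, (a.2 : ℝ))}.Finite := by
  let M : Fin d → ℤ := fun i => ⌈(∑ j, |(w j i : ℝ)|) + |v i|⌉
  refine ((Set.finite_Icc (-M) M).prod (Set.finite_Iic (q * Fintype.card J))).subset ?_
  rintro ⟨α, n⟩ ⟨x, h0, h1, hx⟩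
  rw [coneMap_apply, Prod.mk.injEq] at hx
  obtain ⟨hα, hn⟩ := hx
  have hbound : ∀ i, |(α i : ℝ)| ≤ M i := by
    intro i
    have hi := congrFun hα i
    simp only [Pi.add_apply] at hi
    refine le_trans ?_ (Int.le_ceil _)
    have e : (α i : ℝ) = ∑ j, x j * w j i - v i := by linarith
    rw [e]
    refine (abs_sub _ _).trans (add_le_add_left ((Finset.abs_sum_le_sum_abs _ _).trans
      (Finset.sum_le_sum fun j _ => ?_)) _)
    rw [abs_mul, abs_of_nonneg (h0 j)]
    exact mul_le_of_le_one_left (abs_nonneg _) (h1 j)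
  refine ⟨⟨fun i => ?_, fun i => ?_⟩, ?_⟩
  · have := (abs_le.1 (hbound i)).1
    simp only [Pi.neg_apply]
    exact_mod_cast this
  · have := (abs_le.1 (hbound i)).2
    exact_mod_cast this
  · have hs : ∑ j, x j ≤ Fintype.card J := by
      refine (Finset.sum_le_sum fun j _ => h1 j).trans ?_
      simp
    have : (n : ℝ) ≤ q * Fintype.card J := by
      simp only at hn
      rw [← hn]
      exact mul_le_mul_of_nonneg_left hs (Nat.cast_nonneg _)
    simp only [Set.mem_Iic]
    exact_mod_cast this

/-- The series counting points of a lattice coset in a cone spanned by lattice points of height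
`q` is a polynomial with nonnegative coefficients over `(1 - X ^ q) ^ (d + 1)`. -/
theorem exists_polynomial_of_cone (w : J → Fin d → ℤ) {q : ℕ} (hq : 0 < q)
    (hU : Function.Surjective (coneMap w q)) (v : Fin d → ℝ) :
    ∃ h : Polynomial ℤ, (∀ i, 0 ≤ h.coeff i) ∧
      (1 - PowerSeries.X ^ q) ^ (d + 1) * PowerSeries.mk (fun n =>
        (Nat.card {α : Fin d → ℤ // ∃ x : J → ℝ, 0 ≤ x ∧
          coneMap w q x = ((fun i => (α i : ℝ)) + v, (n : ℝ))} : ℤ)) =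
      PowerSeries.mk (fun n => h.coeff n) := by
  classical
  have hq' : (q : ℝ) ≠ 0 := by positivity
  obtain ⟨T, O, hcard, hdec⟩ := exists_halfOpen_decomposition (coneMap w q) hU
    ((q : ℝ)⁻¹ • LinearMap.snd ℝ (Fin d → ℝ) ℝ) fun x => by
      simp [coneMap_apply, hq']
  let U := coneMap w q
  let pt : (Fin d → ℤ) → ℕ → (Fin d → ℝ) × ℝ := fun α n => ((fun i => (α i : ℝ)) + v, (n : ℝ))
  have hpt : ∀ {α β n m}, pt α n = pt β m → α = β ∧ n = m := by
    intro α β n m h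
    simp only [pt, Prod.mk.injEq, add_left_inj, Nat.cast_inj] at h
    refine ⟨funext fun i => ?_, h.2⟩
    have := congrFun h.1 i
    exact_mod_cast this
  let β := {p : Finset J × (J → ℝ) // p.1 ∈ T ∧ p.2 ∈ coordSubspace (p.1 : Set J) ∧
    (∀ j ∈ p.1, InHalfOpenUnit (j ∈ O p.1) (p.2 j)) ∧ ∃ α n, U p.2 = pt α n}
  have hnn : ∀ p : β, 0 ≤ p.1.2 := by
    intro p j
    by_cases hj : j ∈ p.1.1
    · exact (p.2.2.2.1 j hj).1.1
    · exact (p.2.2.1 j hj).ge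
  have hle : ∀ p : β, p.1.2 ≤ 1 := by
    intro p j
    by_cases hj : j ∈ p.1.1
    · exact (p.2.2.2.1 j hj).2.1
    · rw [p.2.2.1 j hj]
      exact zero_le_one
  choose a h hah using fun p : β => p.2.2.2.2
  have hvalid : ∀ (p : β) (k : J → ℕ), (∀ j ∉ p.1.1, k j = 0) →
      0 ≤ p.1.2 + (fun j => (k j : ℝ)) ∧ p.1.1 ∈ T ∧
      p.1.2 + (fun j => (k j : ℝ)) ∈ coordSubspace (p.1.1 : Set J) ∧
      ∀ j ∈ p.1.1, 0 ≤ (p.1.2 + (fun j => (k j : ℝ))) j ∧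
        (j ∈ O p.1.1 → 0 < (p.1.2 + (fun j => (k j : ℝ))) j) := by
    intro p k hk
    refine ⟨add_nonneg (hnn p) fun j => Nat.cast_nonneg _, p.2.1,
      Submodule.add_mem _ p.2.2.1 fun j hj => by simp [hk j hj], fun j hj => ⟨?_, fun ho => ?_⟩⟩
    · exact add_nonneg (p.2.2.2.1 j hj).1.1 (Nat.cast_nonneg _)
    · exact add_pos_of_pos_of_nonneg ((p.2.2.2.1 j hj).1.2 ho) (Nat.cast_nonneg _)
  have hUadd : ∀ (p : β) (k : J → ℕ), U (p.1.2 + (fun j => (k j : ℝ))) =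
      pt (fun i => a p i + ∑ j, (k j : ℤ) * w j i) (h p + q * ∑ j, k j) := by
    intro p k
    rw [map_add, hah, show U = coneMap w q from rfl, coneMap_natCast]
    ext i
    · simp [pt]
      ring
    · simp [pt]
  have hβ : Finite β := by
    have := (finite_of_bounded_coords (q := q) w v).to_subtype
    refine Finite.of_injective (β := Finset J × {a : (Fin d → ℤ) × ℕ | ∃ x : J → ℝ, 0 ≤ x ∧ x ≤ 1 ∧
      coneMap w q x = ((fun i => (a.1 i : ℝ)) + v, (a.2 : ℝ))})
      (fun p => (p.1.1, ⟨(a p, h p), p.1.2, hnn p, hle p, hah p⟩)) ?_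
    intro p p' hpp
    simp only [Prod.mk.injEq, Subtype.mk.injEq] at hpp
    have hUU : U p.1.2 = U p'.1.2 := by rw [hah, hah, hpp.2.1, hpp.2.2]
    apply Subtype.ext
    refine (hdec p.1.2 (hnn p)).unique ⟨p.2.1, p.2.2.1, rfl, fun j hj => (p.2.2.2.1 j hj).1⟩
      ⟨p'.2.1, p'.2.2.1, hUU.symm, fun j hj => (p'.2.2.2.1 j hj).1⟩
  have := Fintype.ofFinite β
  have hcount : ∀ n : ℕ, Nat.card {α : Fin d → ℤ // ∃ x : J → ℝ, 0 ≤ x ∧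
      coneMap w q x = ((fun i => (α i : ℝ)) + v, (n : ℝ))} =
      Nat.card {x : β × (J → ℕ) //
        (∀ j ∉ x.1.1.1, x.2 j = 0) ∧ h x.1 + q * ∑ j, x.2 j = n} := by
    intro n
    symm
    refine Nat.card_eq_of_bijective (fun x => ⟨fun i => a x.1.1 i + ∑ j, (x.1.2 j : ℤ) * w j i,
      x.1.1.1.2 + (fun j => (x.1.2 j : ℝ)), (hvalid _ _ x.2.1).1, ?_⟩) ⟨?_, ?_⟩
    · rw [hUadd x.1.1 x.1.2, x.2.2]
    · rintro ⟨⟨p, k⟩, hk, hn⟩ ⟨⟨p', k'⟩, hk', hn'⟩ hxx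
      simp only [Subtype.mk.injEq] at hk hn hk' hn' hxx
      have hUU : U (p'.1.2 + (fun j => (k' j : ℝ))) = U (p.1.2 + (fun j => (k j : ℝ))) := by
        rw [hUadd, hUadd, hxx, hn, hn']
      obtain ⟨h0, h1, h2, h3⟩ := hvalid p k hk
      obtain ⟨h0', h1', h2', h3'⟩ := hvalid p' k' hk'
      have heq := (hdec _ h0).unique (y₁ := (p.1.1, p.1.2 + (fun j => (k j : ℝ))))
        (y₂ := (p'.1.1, p'.1.2 + (fun j => (k' j : ℝ)))) ⟨h1, h2, rfl, h3⟩ ⟨h1', h2', hUU, h3'⟩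
      rw [Prod.mk.injEq] at heq
      obtain ⟨hB, hx⟩ := heq
      have hkk : k = k' := by
        funext j
        by_cases hj : j ∈ p.1.1
        · have hb := p'.2.2.2.1 j (hB ▸ hj)
          rw [← hB] at hb
          exact (p.2.2.2.1 j hj).eq_of_add_eq hb (congrFun hx j)
        · rw [hk j hj, hk' j (hB ▸ hj)]
      subst hkk
      have hpp : p = p' := Subtype.ext (Prod.ext hB (add_right_cancel hx))
      subst hpp
      rfl
    · rintro ⟨α, x₀, hx₀, hUx₀⟩
      obtain ⟨⟨B, x⟩, ⟨hB, hxB, hUx, hx⟩, -⟩ := hdec x₀ hx₀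
      simp only at hB hxB hUx hx
      rw [hUx₀] at hUx
      choose! k₀ hk₀ using fun j (hj : j ∈ B) => exists_nat_sub_inHalfOpenUnit (hx j hj)
      let k : J → ℕ := fun j => if j ∈ B then k₀ j else 0
      have hk : ∀ j ∉ B, k j = 0 := fun j hj => by simp [k, hj]
      let x' : J → ℝ := x - fun j => (k j : ℝ)
      have hx'box : ∀ j ∈ B, InHalfOpenUnit (j ∈ O B) (x' j) := fun j hj => by
        simpa [x', k, hj] using hk₀ j hj
      have hx'B : x' ∈ coordSubspace (B : Set J) :=
        Submodule.sub_mem _ hxB fun j hj => by simp [hk j hj]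
      have hx'0 : 0 ≤ x' := fun j => by
        by_cases hj : j ∈ B
        · exact (hx'box j hj).1.1
        · exact (hx'B j hj).ge
      have hadd : x' + (fun j => (k j : ℝ)) = x := by simp [x']
      have hUx' : U x' = ((fun i => (α i : ℝ)) + v, (n : ℝ)) -
          ((fun i => ((∑ j, (k j : ℤ) * w j i : ℤ) : ℝ)), ((q * ∑ j, k j : ℕ) : ℝ)) := by
        rw [← coneMap_natCast, ← hUx, ← map_sub]
      have hn : q * ∑ j, k j ≤ n := by
        have h1 := congrArg Prod.snd hUx'
        rw [show U = coneMap w q from rfl, coneMap_apply] at h1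
        have h2 : (0 : ℝ) ≤ q * ∑ j, x' j :=
          mul_nonneg (Nat.cast_nonneg _) (Finset.sum_nonneg fun j _ => hx'0 j)
        simp only [Prod.snd_sub] at h1
        rw [h1, sub_nonneg] at h2
        exact_mod_cast h2
      let p : β := ⟨(B, x'), hB, hx'B, hx'box, fun i => α i - ∑ j, (k j : ℤ) * w j i,
        n - q * ∑ j, k j, by
          rw [hUx']
          ext i
          · simp [pt]
            ring
          · simp only [pt, Prod.snd_sub]
            rw [Nat.cast_sub hn]⟩
      have hp := hUadd p k
      rw [show p.1.2 + (fun j => (k j : ℝ)) = x from hadd, show U = coneMap w q from rfl, hUx] at hp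
      obtain ⟨e1, e2⟩ := hpt (α := α) (n := n) hp
      exact ⟨⟨(p, k), hk, e2.symm⟩, Subtype.ext e1.symm⟩
  refine ⟨∑ p : β, Polynomial.X ^ h p, fun i => ?_, ?_⟩
  · rw [Polynomial.finsetSum_coeff]
    refine Finset.sum_nonneg fun p _ => ?_
    rw [Polynomial.coeff_X_pow]
    split_ifs <;> simp
  · simp_rw [hcount]
    rw [one_sub_X_pow_mul_series_of_boxes (fun p : β => p.1.1) h hq (m := d + 1)]
    · ext n
      simp [Polynomial.finsetSum_coeff, Polynomial.coeff_X_pow, PowerSeries.coeff_X_pow]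
    · intro p
      rw [hcard _ p.2.1]
      simp

end

section

variable {J : Type*} [Fintype J] {d : ℕ} {w : J → Fin d → ℤ} {q : ℕ} {P : Set (Fin d → ℝ)}

theorem smul_eq_image_stdSimplex
    (hqP : (q : ℝ) • P = convexHull ℝ (Set.range fun j i => (w j i : ℝ))) :
    (q : ℝ) • P = (fun (x : J → ℝ) i => ∑ j, x j * w j i) '' stdSimplex ℝ J := by
  classical
  let f : (J → ℝ) →ₗ[ℝ] Fin d → ℝ := LinearMap.fst ℝ _ _ ∘ₗ coneMap w q
  have hf : ⇑f = fun (x : J → ℝ) i => ∑ j, x j * w j i := by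
    ext x i
    simp [f, coneMap_apply]
  rw [hqP, ← hf, ← convexHull_rangle_single_eq_stdSimplex, LinearMap.image_convexHull,
    ← Set.range_comp]
  congr 2
  ext j i
  simp [hf, Pi.single_apply]

theorem mem_smul_iff_exists_coneMap (hq : 0 < q) (hne : P.Nonempty)
    (hqP : (q : ℝ) • P = convexHull ℝ (Set.range fun j i => (w j i : ℝ)))
    (n : ℕ) (z : Fin d → ℝ) :
    z ∈ (n : ℝ) • P ↔ ∃ x : J → ℝ, 0 ≤ x ∧ coneMap w q x = (z, (n : ℝ)) := by
  have hq' : (q : ℝ) ≠ 0 := by positivity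
  have hQ := smul_eq_image_stdSimplex hqP
  constructor
  · rintro ⟨p, hp, rfl⟩
    obtain ⟨x, hx, hxp⟩ : (q : ℝ) • p ∈ (fun (x : J → ℝ) i => ∑ j, x j * w j i) ''
      stdSimplex ℝ J := hQ ▸ Set.smul_mem_smul_set hp
    refine ⟨((n : ℝ) / q) • x, smul_nonneg (by positivity) hx.1, ?_⟩
    rw [map_smul, coneMap_apply, hx.2]
    ext i
    · have := congrFun hxp i
      simp only [Pi.smul_apply, smul_eq_mul] at this
      simp only [Prod.smul_mk, Pi.smul_apply, smul_eq_mul, this]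
      field_simp
    · simp only [Prod.smul_mk, smul_eq_mul]
      field_simp
  · rintro ⟨x, hx, hxz⟩
    rw [coneMap_apply, Prod.mk.injEq] at hxz
    obtain ⟨hz, hn⟩ := hxz
    rcases Nat.eq_zero_or_pos n with rfl | hpos
    · have hs : ∑ j, x j = 0 := by simpa [hq'] using hn
      rw [Finset.sum_eq_zero_iff_of_nonneg fun j _ => hx j] at hs
      obtain ⟨p, hp⟩ := hne
      refine ⟨p, hp, ?_⟩
      rw [← hz]
      ext i
      simp [hs]
    · have hn' : (n : ℝ) ≠ 0 := by positivity
      have hmem : (fun i => ∑ j, (((q : ℝ) / n) • x) j * w j i) ∈ (q : ℝ) • P := by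
        rw [hQ]
        refine ⟨_, ⟨fun j => mul_nonneg (by positivity) (hx j), ?_⟩, rfl⟩
        simp only [← Finset.mul_sum]
        field_simp
        exact hn
      obtain ⟨p, hp, hpx⟩ := hmem
      refine ⟨p, hp, ?_⟩
      rw [← hz]
      ext i
      have := congrFun hpx i
      simp only [Pi.smul_apply, smul_eq_mul, mul_assoc, ← Finset.mul_sum] at this ⊢
      field_simp at this
      linarith

theorem coneMap_surjective (hq : 0 < q) (hfull : affineSpan ℝ P = ⊤)
    (hqP : (q : ℝ) • P = convexHull ℝ (Set.range fun j i => (w j i : ℝ))) :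
    Function.Surjective (coneMap w q) := by
  have hne : P.Nonempty := by
    rw [← affineSpan_nonempty ℝ, hfull]
    exact ⟨0, trivial⟩
  have key : ∀ z : Fin d → ℝ, (z, (1 : ℝ)) ∈ LinearMap.range (coneMap w q) := by
    intro z
    have hz : z ∈ affineSpan ℝ P := hfull ▸ trivial
    refine affineSpan_induction (p := fun z => (z, (1 : ℝ)) ∈ LinearMap.range (coneMap w q)) hz
      (fun p hp => ?_) fun c a b e ha hb he => ?_
    · obtain ⟨x, -, hx⟩ := (mem_smul_iff_exists_coneMap hq hne hqP 1 p).1 (by simpa using hp)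
      exact ⟨x, by simpa using hx⟩
    · have := Submodule.add_mem _ (Submodule.smul_mem _ c (Submodule.sub_mem _ ha hb)) he
      simpa using this
  rintro ⟨z, t⟩
  have := Submodule.add_mem _ (Submodule.sub_mem _ (key z) (key 0)) (Submodule.smul_mem _ t (key 0))
  simpa using this

end

/-- for a full-dimensional rational polytope `P` with denominator
`q` and a rational vector `v` with denominator `q`, the series
`∑_{n ≥ 0} |(nP − v) ∩ ℤ^d| tⁿ` times `(1 − t^q)^{d+1}` is a polynomial with
nonnegative integer coefficients. -/
theorem shifted_rational_Ehrhart_series_rationality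
    {d : ℕ} (P : Set (Fin d → ℝ))
    (hP : ∃ V : Finset (Fin d → ℚ),
      P = convexHull ℝ ((fun (x : Fin d → ℚ) => (fun i => (x i : ℝ))) '' (V : Set (Fin d → ℚ))))
    (hfull : affineSpan ℝ P = ⊤)
    (q : ℕ) (hq : 0 < q)
    (hqP : ∃ W : Finset (Fin d → ℤ),
      (q : ℝ) • P = convexHull ℝ ((fun (w : Fin d → ℤ) => (fun i => (w i : ℝ))) '' (W : Set (Fin d → ℤ))))
    (v : Fin d → ℝ) (hv : ∀ i, ∃ m : ℤ, (q : ℝ) * v i = (m : ℝ)) :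
    ∃ h : Polynomial ℤ, (∀ i, 0 ≤ h.coeff i) ∧
      (1 - PowerSeries.X ^ q) ^ (d + 1) *
        PowerSeries.mk (fun n =>
          (Nat.card {α : Fin d → ℤ // (fun i => (α i : ℝ)) + v ∈ (n : ℝ) • P} : ℤ))
      = PowerSeries.mk (fun n => h.coeff n) := by
  obtain ⟨W, hW⟩ := hqP
  let w : W → Fin d → ℤ := fun j => j.1
  have hqP : (q : ℝ) • P = convexHull ℝ (Set.range fun j i => (w j i : ℝ)) := by
    rw [hW]
    congr 1
    ext z
    simp [w]
  have hne : P.Nonempty := by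
    rw [← affineSpan_nonempty ℝ, hfull]
    exact ⟨0, trivial⟩
  simp_rw [mem_smul_iff_exists_coneMap hq hne hqP]
  exact exists_polynomial_of_cone w hq (coneMap_surjective hq hfull hqP) v
end

section
/- Let P ⊆ ℝ^d be a full-dimensional lattice polytope (the convex hull of finitely many points of ℤ^d). Then there exists a polynomial h*(t) with nonnegative integer coefficients such that, in ℤ⟦t⟧, (1 − t)^{d+1} · ∑_{n ≥ 0} |nP ∩ ℤ^d| · t^n = h*(t). -/
open scoped Pointwise

open Module

section Peel

variable {E κ : Type*} [AddCommGroup E] [Module ℝ E]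

/-- Points of `L` at height `n` whose coordinates satisfy `p`, the coordinates in `T` being
minimal under subtraction of `1`. -/
def peeledSlice (L : AddSubgroup E) (h : E →ₗ[ℝ] ℝ) (b : Basis κ ℝ E) (p : κ → ℝ → Prop)
    (T : Finset κ) (n : ℕ) : Set E :=
  {x | x ∈ L ∧ (∀ i, p i (b.coord i x)) ∧ (∀ i ∈ T, ¬ p i (b.coord i x - 1)) ∧ h x = n}

variable {L : AddSubgroup E} {h : E →ₗ[ℝ] ℝ} {b : Basis κ ℝ E} {p : κ → ℝ → Prop}

lemma height_eq_sum_coord [Fintype κ] (hb1 : ∀ i, h (b i) = 1) (x : E) :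
    h x = ∑ i, b.coord i x := by
  conv_lhs => rw [← b.sum_repr x]
  simp only [map_sum, map_smul, hb1, smul_eq_mul, mul_one, Basis.coord_apply]

lemma peeledSlice_insert_zero [Fintype κ] [DecidableEq κ] (hb1 : ∀ i, h (b i) = 1)
    (hp0 : ∀ i a, p i a → 0 ≤ a)
    {T : Finset κ} {j : κ} :
    peeledSlice L h b p (insert j T) 0 = peeledSlice L h b p T 0 := by
  ext x
  simp only [peeledSlice, Set.mem_ofPred_eq, Finset.forall_mem_insert]
  constructor
  · tauto
  · rintro ⟨hL, hp, hT, hx⟩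
    refine ⟨hL, hp, ⟨fun hj => ?_, hT⟩, hx⟩
    have h1 : 1 ≤ b.coord j x := by linarith [hp0 _ _ hj]
    have h2 : b.coord j x ≤ ∑ i, b.coord i x :=
      Finset.single_le_sum (f := fun i => b.coord i x) (fun i _ => hp0 _ _ (hp i))
        (Finset.mem_univ j)
    rw [← height_eq_sum_coord hb1, hx] at h2
    rw [Nat.cast_zero] at h2
    linarith

lemma ncard_peeledSlice_succ [DecidableEq κ] (hbL : ∀ i, b i ∈ L) (hb1 : ∀ i, h (b i) = 1)
    (hp1 : ∀ i a, p i a → p i (a + 1))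
    (hfin : ∀ n, (peeledSlice L h b p ∅ n).Finite) {T : Finset κ} {j : κ} (hj : j ∉ T) (n : ℕ) :
    (peeledSlice L h b p T (n + 1)).ncard =
      (peeledSlice L h b p (insert j T) (n + 1)).ncard + (peeledSlice L h b p T n).ncard := by
  have hsub : ∀ T n, (peeledSlice L h b p T n).Finite := fun T n =>
    (hfin n).subset fun x hx => ⟨hx.1, hx.2.1, by simp, hx.2.2.2⟩
  have himg : ((fun x => x + b j) '' peeledSlice L h b p T n).ncard =
      (peeledSlice L h b p T n).ncard :=
    Set.ncard_image_of_injective _ (add_left_injective _)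
  rw [← himg, ← Set.ncard_union_eq _ (hsub _ _) ((hsub _ _).image _)]
  · congr 1
    ext x
    simp only [Set.mem_union, Set.mem_image]
    constructor
    · rintro ⟨hL, hp, hT, hx⟩
      by_cases hjx : p j (b.coord j x - 1)
      · refine Or.inr ⟨x - b j, ⟨L.sub_mem hL (hbL j), fun i => ?_, fun i hi => ?_, ?_⟩, by simp⟩
        · by_cases hij : i = j
          · subst hij; simpa using hjx
          · simpa [Finsupp.single_apply, Ne.symm hij] using hp i
        · have hij : j ≠ i := fun e => hj (e ▸ hi)
          simpa [Finsupp.single_apply, hij] using hT i hi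
        · rw [map_sub, hx, hb1]; push_cast; ring
      · exact Or.inl ⟨hL, hp, by simpa [Finset.forall_mem_insert] using ⟨hjx, hT⟩, hx⟩
    · rintro (⟨hL, hp, hT, hx⟩ | ⟨x, ⟨hL, hp, hT, hx⟩, rfl⟩)
      · exact ⟨hL, hp, fun i hi => hT i (Finset.mem_insert_of_mem hi), hx⟩
      · refine ⟨L.add_mem hL (hbL j), fun i => ?_, fun i hi => ?_, ?_⟩
        · by_cases hij : i = j
          · subst hij; simpa using hp1 _ _ (hp i)
          · simpa [Finsupp.single_apply, Ne.symm hij] using hp i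
        · have hij : j ≠ i := fun e => hj (e ▸ hi)
          simpa [Finsupp.single_apply, hij] using hT i hi
        · rw [map_add, hx, hb1]; push_cast; ring
  · rw [Set.disjoint_left]
    rintro _ ⟨_, _, hT, _⟩ ⟨x, ⟨_, hp, _, _⟩, rfl⟩
    exact hT j (Finset.mem_insert_self _ _) (by simpa using hp j)

lemma one_sub_X_pow_mul_peeledSlice [Fintype κ] [DecidableEq κ] (hbL : ∀ i, b i ∈ L)
    (hb1 : ∀ i, h (b i) = 1) (hp0 : ∀ i a, p i a → 0 ≤ a) (hp1 : ∀ i a, p i a → p i (a + 1))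
    (hfin : ∀ n, (peeledSlice L h b p ∅ n).Finite) (T : Finset κ) :
    (1 - PowerSeries.X) ^ T.card *
      PowerSeries.mk (fun n => ((peeledSlice L h b p ∅ n).ncard : ℤ)) =
    PowerSeries.mk (fun n => ((peeledSlice L h b p T n).ncard : ℤ)) := by
  induction T using Finset.induction_on with
  | empty => simp
  | insert j T hj ih =>
    rw [Finset.card_insert_of_notMem hj, pow_succ', mul_assoc, ih]
    ext n
    rw [sub_mul, one_mul]
    cases n with
    | zero => simp [peeledSlice_insert_zero hb1 hp0]
    | succ n =>
      rw [map_sub, PowerSeries.coeff_succ_X_mul]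
      simp [ncard_peeledSlice_succ hbL hb1 hp1 hfin hj n]

lemma peeledSlice_univ_eq_empty [Fintype κ] (hb1 : ∀ i, h (b i) = 1) (hp : ∀ i a, 0 < a → p i a)
    {n : ℕ} (hn : Fintype.card κ < n) : peeledSlice L h b p Finset.univ n = ∅ := by
  rw [Set.eq_empty_iff_forall_notMem]
  rintro x ⟨-, -, hT, hx⟩
  have h1 : ∀ i, b.coord i x ≤ 1 := fun i => by
    by_contra! hi
    exact hT i (Finset.mem_univ i) (hp _ _ (by linarith))
  have h2 : h x ≤ Fintype.card κ := by
    rw [height_eq_sum_coord hb1]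
    simpa using Finset.sum_le_sum fun i (_ : i ∈ Finset.univ) => h1 i
  rw [hx] at h2
  exact absurd (by exact_mod_cast h2) hn.not_ge

end Peel

lemma exists_pos_forall_dual_ne_zero {ι K : Type*} [Finite ι] [Finite K]
    (f : K → Dual ℝ (ι → ℝ)) (hf : ∀ k, ∃ x, f k x ≠ 0) :
    ∃ w : ι → ℝ, (∀ i, 0 < w i) ∧ ∀ k, f k w ≠ 0 := by
  obtain ⟨z, hz⟩ := Dual.exists_forall_ne_zero_of_forall_exists f hf
  have hpos : ∀ᶠ δ : ℝ in nhdsWithin 0 (Set.Ioi 0), ∀ i, 0 < 1 + δ * z i := by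
    rw [Filter.eventually_all]
    intro i
    have : Filter.Tendsto (fun δ : ℝ => 1 + δ * z i) (nhds 0) (nhds (1 + 0 * z i)) :=
      Continuous.tendsto (by fun_prop) 0
    exact (this.mono_left nhdsWithin_le_nhds).eventually (lt_mem_nhds (by simp))
  have hne : ∀ᶠ δ : ℝ in nhdsWithin 0 (Set.Ioi 0), ∀ k, f k 1 + δ * f k z ≠ 0 := by
    rw [Filter.eventually_all]
    intro k
    have hfinite : {δ : ℝ | f k 1 + δ * f k z = 0}.Finite :=
      (Set.finite_singleton (-(f k 1) / f k z)).subset fun δ hδ => by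
        have hδ' : f k 1 + δ * f k z = 0 := hδ
        rw [Set.mem_singleton_iff, eq_div_iff (hz k)]
        linarith
    have hle : nhdsWithin (0 : ℝ) (Set.Ioi 0) ≤ Filter.cofinite :=
      (nhdsGT_le_nhdsNE 0).trans (nhdsNE_le_cofinite 0)
    exact hle hfinite.compl_mem_cofinite
  obtain ⟨δ, h1, h2⟩ := (hpos.and hne).exists
  exact ⟨1 + δ • z, by simpa using h1, fun k => by simpa using h2 k⟩

/-- Positivity of `a + ε * b` for small `ε > 0`, provided `b ≠ 0`. -/
def LexPos (b a : ℝ) : Prop := 0 < a ∨ a = 0 ∧ 0 < b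

lemma eventually_lexPos_iff {a b : ℝ} (hb : b ≠ 0) :
    ∀ᶠ ε : ℝ in nhdsWithin 0 (Set.Ioi 0), a + ε * b ≠ 0 ∧ (0 < a + ε * b ↔ LexPos b a) := by
  have hlim : Filter.Tendsto (fun ε : ℝ => a + ε * b) (nhdsWithin 0 (Set.Ioi 0)) (nhds a) := by
    have : Filter.Tendsto (fun ε : ℝ => a + ε * b) (nhds 0) (nhds (a + 0 * b)) :=
      Continuous.tendsto (by fun_prop) 0
    simpa using this.mono_left (nhdsWithin_le_nhds (s := Set.Ioi 0))
  rcases lt_trichotomy a 0 with ha | ha | ha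
  · filter_upwards [hlim.eventually (gt_mem_nhds ha)] with ε hε
    exact ⟨hε.ne, by simp [LexPos, hε.not_gt, ha.not_gt, ha.ne]⟩
  · filter_upwards [self_mem_nhdsWithin] with ε hε
    have hε : 0 < ε := hε
    subst ha
    simp [LexPos, hb, hε.ne', hε]
  · filter_upwards [hlim.eventually (lt_mem_nhds ha)] with ε hε
    exact ⟨hε.ne', by simp [LexPos, hε, ha]⟩

section Triangulation

variable {E ι : Type*} [AddCommGroup E] [Module ℝ E] (v : ι → E)

/-- The index sets of the bases of `E` contained in the family `v`. -/
def Subbasis : Type _ :=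
  {B : Set ι // LinearIndepOn ℝ v B ∧ ⊤ ≤ Submodule.span ℝ (v '' B)}

namespace Subbasis

variable {v}

instance [Finite ι] : Finite (Subbasis v) := inferInstanceAs (Finite {_B : Set ι // _})

/-- The basis with a given index set. -/
noncomputable def basis (B : Subbasis v) : Basis B.1 ℝ E :=
  Basis.mk (v := fun i : B.1 => v i) B.2.1 (by
    have : Set.range (fun i : B.1 => v i) = v '' B.1 := by
      rw [Set.image_eq_range]
    rw [this]
    exact B.2.2)

@[simp] lemma basis_apply (B : Subbasis v) (i : B.1) : B.basis i = v i := by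
  exact Basis.mk_apply _ _ i

/-- The linear functional taking the values `c` on the basis. -/
noncomputable def price (B : Subbasis v) (c : ι → ℝ) : E →ₗ[ℝ] ℝ :=
  B.basis.constr ℝ fun i => c i

lemma price_apply_mem (B : Subbasis v) (c : ι → ℝ) {i : ι} (hi : i ∈ B.1) :
    B.price c (v i) = c i := by
  rw [← B.basis_apply ⟨i, hi⟩, price, Basis.constr_basis]

/-- Dual feasibility: the lifted simplex is a lower facet for the heights `c`. -/
def IsLower (B : Subbasis v) (c : ι → ℝ) : Prop := ∀ j ∉ B.1, B.price c (v j) < c j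

variable [Fintype ι]

lemma eq_sum_coord (B : Subbasis v) (y : E) :
    ∃ w : ι → ℝ, (∀ i : B.1, w i = B.basis.coord i y) ∧ (∀ i ∉ B.1, w i = 0) ∧
      ∑ i, w i • v i = y ∧ ∀ c : ι → ℝ, B.price c y = ∑ i, w i * c i := by
  classical
  let w : ι → ℝ := fun i => if hi : i ∈ B.1 then B.basis.coord ⟨i, hi⟩ y else 0
  have hsum : ∑ i, w i • v i = y := by
    rw [← Finset.sum_subset (Finset.subset_univ (Finset.univ.filter (· ∈ B.1)))
      (by
          intro i _ hi
          simp only [Finset.mem_filter, Finset.mem_univ, true_and] at hi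
          simp [w, hi])]
    rw [Finset.sum_subtype (p := (· ∈ B.1)) _ (by simp)]
    conv_rhs => rw [← B.basis.sum_repr y]
    exact Finset.sum_congr rfl fun i _ => by simp [w]
  refine ⟨w, fun i => by simp [w], fun i hi => by simp [w, hi], hsum, fun c => ?_⟩
  conv_lhs => rw [← hsum]
  rw [map_sum]
  refine Finset.sum_congr rfl fun i _ => ?_
  by_cases hi : i ∈ B.1
  · rw [map_smul, B.price_apply_mem c hi, smul_eq_mul]
  · simp [w, hi]

lemma unique_of_isLower {B B' : Subbasis v} {c : ι → ℝ} {y : E} (hB : B.IsLower c)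
    (hB' : B'.IsLower c) (hy : ∀ i, 0 < B.basis.coord i y)
    (hy' : ∀ i, 0 < B'.basis.coord i y) : B = B' := by
  have key : ∀ {B B' : Subbasis v}, B.IsLower c → (∀ i, 0 < B'.basis.coord i y) →
      B.price c y ≤ B'.price c y ∧ (B'.price c y ≤ B.price c y → B'.1 ⊆ B.1) := by
    intro B B' hB hy'
    obtain ⟨w, hw, hw0, hwy, hwp⟩ := B'.eq_sum_coord y
    have hle : ∀ j, B.price c (v j) ≤ c j := fun j => by
      by_cases hj : j ∈ B.1
      · exact (B.price_apply_mem c hj).le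
      · exact (hB j hj).le
    have hwnn : ∀ j, 0 ≤ w j := fun j => by
      by_cases hj : j ∈ B'.1
      · exact (hw ⟨j, hj⟩ ▸ hy' ⟨j, hj⟩).le
      · exact (hw0 j hj).ge
    have h1 : B.price c y = ∑ j, w j * B.price c (v j) := by
      conv_lhs => rw [← hwy]
      simp
    rw [hwp, h1]
    refine ⟨Finset.sum_le_sum fun j _ => mul_le_mul_of_nonneg_left (hle j) (hwnn j), ?_⟩
    intro hge j hj
    by_contra hjB
    refine hge.not_gt (Finset.sum_lt_sum
      (fun j _ => mul_le_mul_of_nonneg_left (hle j) (hwnn j)) ⟨j, Finset.mem_univ j, ?_⟩)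
    exact mul_lt_mul_of_pos_left (hB j hjB) (hw ⟨j, hj⟩ ▸ hy' ⟨j, hj⟩)
  have h1 := key hB hy'
  have h2 := key hB' hy
  exact Subtype.ext ((h2.2 h1.1).antisymm (h1.2 h2.1))

/-- A conic Carathéodory theorem which does not increase the cost. -/
lemma exists_pos_coord_price_le (hv : Submodule.span ℝ (Set.range v) = ⊤) {h : E →ₗ[ℝ] ℝ}
    (hh : ∀ i, h (v i) = 1) (c : ι → ℝ) {y : E}
    (hy : ∀ (B : Subbasis v) i, B.basis.coord i y ≠ 0) (w : ι → ℝ) (hw : ∀ i, 0 ≤ w i)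
    (hwy : ∑ i, w i • v i = y) :
    ∃ B : Subbasis v, (∀ i, 0 < B.basis.coord i y) ∧ B.price c y ≤ ∑ i, w i * c i := by
  classical
  induction hn : (Finset.univ.filter (w · ≠ 0)).card using Nat.strong_induction_on
    generalizing w with
  | _ n ih =>
  by_cases hli : LinearIndepOn ℝ v {i | w i ≠ 0}
  · obtain ⟨B, -, hsub, hspan, hB⟩ := exists_linearIndepOn_extension hli (Set.subset_univ _)
    have hBtop : ⊤ ≤ Submodule.span ℝ (v '' B) := by
      rw [← hv, Submodule.span_le, ← Set.image_univ]
      exact hspan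
    let B' : Subbasis v := ⟨B, hB, hBtop⟩
    obtain ⟨u, hu, hu0, huy, hup⟩ := B'.eq_sum_coord y
    have huw : u = w := by
      have h0 : ∑ i, (u i - w i) • v i = 0 := by
        simp [sub_smul, Finset.sum_sub_distrib, huy, hwy]
      have hout : ∀ i ∉ B, u i - w i = 0 := fun i hi => by
        have : w i = 0 := by
          by_contra hne
          exact hi (hsub hne)
        rw [hu0 i hi, this, sub_zero]
      have h1 : ∑ i ∈ Finset.univ.filter (· ∈ B), (u i - w i) • v i = 0 := by
        rw [← h0]
        refine Finset.sum_subset (Finset.subset_univ _) fun i _ hi => ?_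
        rw [hout i (by simpa using hi), zero_smul]
      have h2 := linearIndepOn_iff'.1 hB _ _ (by intro i; simp) h1
      funext i
      by_cases hi : i ∈ B
      · exact sub_eq_zero.1 (h2 i (by simpa using hi))
      · exact sub_eq_zero.1 (hout i hi)
    refine ⟨B', fun i => ?_, ?_⟩
    · refine lt_of_le_of_ne ?_ (hy B' i).symm
      rw [← hu i, huw]
      exact hw i
    · rw [hup, huw]
  · obtain ⟨g, hgv, hgw, hgne, hgc⟩ : ∃ g : ι → ℝ, ∑ i, g i • v i = 0 ∧
        (∀ i, w i = 0 → g i = 0) ∧ (∃ i ∈ Finset.univ, g i ≠ 0) ∧ 0 ≤ ∑ i, g i * c i := by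
      rw [linearIndepOn_iff'] at hli
      push Not at hli
      obtain ⟨t, g, ht, hg, i, hi, hne⟩ := hli
      have hA : ∑ i, (if i ∈ t then g i else 0) • v i = 0 := by
        simpa [ite_smul, Finset.sum_ite_mem] using hg
      have hB : ∀ i, w i = 0 → (if i ∈ t then g i else 0) = 0 := fun i hwi =>
        if_neg fun hit => ht hit hwi
      have hC : ∃ i ∈ Finset.univ, (if i ∈ t then g i else 0) ≠ 0 :=
        ⟨i, Finset.mem_univ i, by simpa [hi] using hne⟩
      obtain ⟨g', hA, hB, hC⟩ : ∃ g' : ι → ℝ, ∑ i, g' i • v i = 0 ∧ (∀ i, w i = 0 → g' i = 0) ∧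
          ∃ i ∈ Finset.univ, g' i ≠ 0 := ⟨_, hA, hB, hC⟩
      rcases le_total 0 (∑ i, g' i * c i) with hs | hs
      · exact ⟨g', hA, hB, hC, hs⟩
      · exact ⟨-g', by simpa using hA, by simpa using hB, by simpa using hC, by simpa using hs⟩
    have hg0 : ∑ i, g i = 0 := by
      simpa [hh] using congrArg h hgv
    obtain ⟨k₀, -, hk₀⟩ := Finset.exists_pos_of_sum_zero_of_exists_nonzero g hg0 hgne
    obtain ⟨k, hk, hmin⟩ := Finset.exists_min_image (Finset.univ.filter (0 < g ·))
      (fun i => w i / g i) ⟨k₀, by simpa using hk₀⟩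
    have hk : 0 < g k := by simpa using hk
    let s := w k / g k
    have hs : 0 ≤ s := div_nonneg (hw k) hk.le
    have hw' : ∀ i, 0 ≤ w i - s * g i := fun i => by
      rcases le_or_gt (g i) 0 with hi | hi
      · nlinarith [hw i]
      · have := hmin i (by simpa using hi)
        have := (le_div_iff₀ hi).1 this
        simpa [s] using this
    have hcard : (Finset.univ.filter fun i => w i - s * g i ≠ 0).card < n := by
      rw [← hn]
      refine Finset.card_lt_card ⟨fun i hi => ?_, fun hsub => ?_⟩
      · simp only [Finset.mem_filter, Finset.mem_univ, true_and] at hi ⊢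
        exact fun h0 => hi (by rw [h0, hgw i h0]; simp)
      · have hwk : w k ≠ 0 := fun h0 => hk.ne' (hgw k h0)
        have := hsub (Finset.mem_filter.2 ⟨Finset.mem_univ k, hwk⟩)
        simp [s, hk.ne'] at this
    have hwy' : ∑ i, (w i - s * g i) • v i = y := by
      simp only [sub_smul, mul_smul, Finset.sum_sub_distrib, ← Finset.smul_sum, hgv, hwy,
        smul_zero, sub_zero]
    obtain ⟨B, hB, hBc⟩ := ih _ hcard (fun i => w i - s * g i) hw' hwy' rfl
    refine ⟨B, hB, hBc.trans ?_⟩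
    have : ∑ i, (w i - s * g i) * c i = ∑ i, w i * c i - s * ∑ i, g i * c i := by
      rw [Finset.mul_sum, ← Finset.sum_sub_distrib]
      exact Finset.sum_congr rfl fun i _ => by ring
    rw [this]
    nlinarith

lemma exists_isLower (hv : Submodule.span ℝ (Set.range v) = ⊤) {h : E →ₗ[ℝ] ℝ}
    (hh : ∀ i, h (v i) = 1) {c : ι → ℝ}
    (hc : ∀ (B : Subbasis v), ∀ j ∉ B.1, c j - B.price c (v j) ≠ 0) {y : E}
    (hy : ∀ (B : Subbasis v) i, B.basis.coord i y ≠ 0) (w : ι → ℝ) (hw : ∀ i, 0 ≤ w i)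
    (hwy : ∑ i, w i • v i = y) :
    ∃ B : Subbasis v, B.IsLower c ∧ ∀ i, 0 < B.basis.coord i y := by
  classical
  obtain ⟨B₀, hB₀, -⟩ := exists_pos_coord_price_le hv hh c hy w hw hwy
  obtain ⟨B, hB, hmin⟩ := Set.exists_min_image
    {B : Subbasis v | ∀ i, 0 < B.basis.coord i y} (fun B => B.price c y) (Set.toFinite _) ⟨B₀, hB₀⟩
  have hB : ∀ i, 0 < B.basis.coord i y := hB
  refine ⟨B, fun j hj => ?_, hB⟩
  by_contra! hlt
  have hlt : c j < B.price c (v j) := lt_of_le_of_ne hlt fun e => hc B j hj (by rw [← e, sub_self])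
  obtain ⟨u, hu, hu0, huy, hup⟩ := B.eq_sum_coord y
  obtain ⟨a, -, ha0, hav, hap⟩ := B.eq_sum_coord (v j)
  have hev : ∀ᶠ s : ℝ in nhdsWithin 0 (Set.Ioi 0), 0 < s ∧ ∀ i : B.1, 0 < u i - s * a i := by
    refine Filter.Eventually.and self_mem_nhdsWithin (Filter.eventually_all.2 fun i => ?_)
    have : Filter.Tendsto (fun s : ℝ => u i - s * a i) (nhds 0) (nhds (u i - 0 * a i)) :=
      Continuous.tendsto (by fun_prop) 0
    exact (this.mono_left nhdsWithin_le_nhds).eventually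
      (lt_mem_nhds (by simpa [hu i] using hB i))
  obtain ⟨s, hs, hsu⟩ := hev.exists
  have hpos : ∀ i, 0 ≤ u i - s * a i + if i = j then s else 0 := fun i => by
    by_cases hi : i ∈ B.1
    · have := hsu ⟨i, hi⟩
      split_ifs <;> linarith
    · simp only [hu0 i hi, ha0 i hi]
      split_ifs <;> simp [hs.le]
  have hsum : ∑ i, (u i - s * a i + if i = j then s else 0) • v i = y := by
    simp only [add_smul, sub_smul, mul_smul, ite_smul, zero_smul, Finset.sum_add_distrib,
      Finset.sum_sub_distrib, ← Finset.smul_sum, hav, huy, Finset.sum_ite_eq', Finset.mem_univ,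
      if_true, sub_add_cancel]
  obtain ⟨B', hB', hle⟩ := exists_pos_coord_price_le hv hh c hy _ hpos hsum
  refine (hmin B' hB').not_gt (hle.trans_lt ?_)
  have : ∑ i, (u i - s * a i + if i = j then s else 0) * c i =
      ∑ i, u i * c i - s * ∑ i, a i * c i + s * c j := by
    simp only [add_mul, sub_mul, ite_mul, zero_mul, Finset.sum_add_distrib,
      Finset.sum_sub_distrib, Finset.sum_ite_eq', Finset.mem_univ, if_true, Finset.mul_sum,
      mul_assoc]
  rw [this, ← hup, ← hap]
  nlinarith

end Subbasis

end Triangulation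

/-- The lattice points at height `n` in the cone generated by `v`. -/
def coneSlice {E ι : Type*} [AddCommGroup E] [Module ℝ E] [Fintype ι] (L : AddSubgroup E)
    (h : E →ₗ[ℝ] ℝ) (v : ι → E) (n : ℕ) : Set E :=
  {x | x ∈ L ∧ (∃ w : ι → ℝ, (∀ i, 0 ≤ w i) ∧ ∑ i, w i • v i = x) ∧ h x = n}

section Decomposition

variable {E ι : Type*} [AddCommGroup E] [Module ℝ E] [Fintype ι] {v : ι → E}

lemma exists_generic_point :
    ∃ w : ι → ℝ, (∀ i, 0 < w i) ∧
      ∀ (B : Subbasis v) (i : B.1), B.basis.coord i (∑ j, w j • v j) ≠ 0 := by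
  classical
  let f : (Σ B : Subbasis v, B.1) → Dual ℝ (ι → ℝ) := fun k =>
    k.1.basis.coord k.2 ∘ₗ Fintype.linearCombination ℝ v
  obtain ⟨w, hw, hf⟩ := exists_pos_forall_dual_ne_zero f fun ⟨B, i⟩ => ⟨Pi.single i.1 1, by
    rw [LinearMap.comp_apply, Fintype.linearCombination_apply_single, one_smul]
    change B.basis.coord i (v i) ≠ 0
    rw [← B.basis_apply i]
    simp only [Basis.coord_apply, Basis.repr_self, Finsupp.single_eq_same]
    exact one_ne_zero⟩
  exact ⟨w, hw, fun B i => by simpa [f, Fintype.linearCombination_apply] using hf ⟨B, i⟩⟩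

lemma exists_generic_heights :
    ∃ c : ι → ℝ, ∀ B : Subbasis v, ∀ j ∉ B.1, c j - B.price c (v j) ≠ 0 := by
  classical
  let f : (Σ B : Subbasis v, {j : ι // j ∉ B.1}) → Dual ℝ (ι → ℝ) := fun k =>
    LinearMap.proj k.2.1 - LinearMap.applyₗ (v k.2) ∘ₗ (k.1.basis.constr ℝ).toLinearMap ∘ₗ
      LinearMap.funLeft ℝ ℝ Subtype.val
  have hf : ∀ k c, f k c = c k.2.1 - k.1.price c (v k.2) := fun k c => rfl
  obtain ⟨c, -, hc⟩ := exists_pos_forall_dual_ne_zero f fun ⟨B, j⟩ => ⟨Pi.single j.1 1, by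
    have : B.price (Pi.single j.1 1) = 0 := B.basis.ext fun i => by
      have hij : (i : ι) ≠ j := fun e => j.2 (e ▸ i.2)
      rw [B.basis_apply, B.price_apply_mem _ i.2]
      simp [hij]
    rw [hf, this]
    simp⟩
  exact ⟨c, fun B j hj => hf ⟨B, j, hj⟩ c ▸ hc ⟨B, j, hj⟩⟩

/-- A slice of a cone is partitioned by slices of half-open simplicial cones. -/
lemma exists_halfOpen_decomposition_s11 (hv : Submodule.span ℝ (Set.range v) = ⊤) {h : E →ₗ[ℝ] ℝ}
    (hh : ∀ i, h (v i) = 1) (L : AddSubgroup E) :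
    ∃ (S : Set (Subbasis v)) (q : E), ∀ n,
      coneSlice L h v n = ⋃ B : S, peeledSlice L h B.1.basis
        (fun i => LexPos (B.1.basis.coord i q)) ∅ n ∧
      Pairwise (Function.onFun Disjoint fun B : S => peeledSlice L h B.1.basis
        (fun i => LexPos (B.1.basis.coord i q)) ∅ n) := by
  obtain ⟨w₀, hw₀, hq⟩ := exists_generic_point (v := v)
  obtain ⟨c, hc⟩ := exists_generic_heights (v := v)
  set q := ∑ j, w₀ j • v j with hqdef
  have hε : ∀ x : E, ∃ ε : ℝ, 0 < ε ∧ ∀ (B : Subbasis v) (i : B.1),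
      B.basis.coord i (x + ε • q) ≠ 0 ∧
      (0 < B.basis.coord i (x + ε • q) ↔ LexPos (B.basis.coord i q) (B.basis.coord i x)) := by
    intro x
    have hev : ∀ᶠ ε : ℝ in nhdsWithin 0 (Set.Ioi 0), 0 < ε ∧ ∀ (B : Subbasis v) (i : B.1),
        B.basis.coord i (x + ε • q) ≠ 0 ∧
        (0 < B.basis.coord i (x + ε • q) ↔
          LexPos (B.basis.coord i q) (B.basis.coord i x)) := by
      refine Filter.Eventually.and self_mem_nhdsWithin
        (Filter.eventually_all.2 fun B => Filter.eventually_all.2 fun i => ?_)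
      simp only [map_add, map_smul, smul_eq_mul]
      exact eventually_lexPos_iff (hq B i)
    exact hev.exists
  refine ⟨{B | B.IsLower c}, q, fun n => ⟨?_, ?_⟩⟩
  · ext x
    simp only [Set.mem_iUnion]
    constructor
    · rintro ⟨hL, ⟨w, hw, hwx⟩, hx⟩
      obtain ⟨ε, hε0, hε⟩ := hε x
      obtain ⟨B, hB, hpos⟩ := Subbasis.exists_isLower hv hh hc (y := x + ε • q)
        (fun B i => (hε B i).1) (fun i => w i + ε * w₀ i)
        (fun i => add_nonneg (hw i) (mul_nonneg hε0.le (hw₀ i).le))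
        (by simp only [add_smul, mul_smul, Finset.sum_add_distrib, ← Finset.smul_sum, hwx, hqdef])
      exact ⟨⟨B, hB⟩, hL, fun i => (hε B i).2.1 (hpos i), by simp, hx⟩
    · rintro ⟨B, hL, hp, -, hx⟩
      obtain ⟨u, hu, hu0, hux, -⟩ := B.1.eq_sum_coord x
      refine ⟨hL, ⟨u, fun i => ?_, hux⟩, hx⟩
      by_cases hi : i ∈ B.1.1
      · rw [hu ⟨i, hi⟩]
        rcases hp ⟨i, hi⟩ with h0 | h0
        exacts [h0.le, h0.1.ge]
      · exact (hu0 i hi).ge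
  · intro B B' hne
    refine Set.disjoint_left.2 fun x hx hx' => hne ?_
    obtain ⟨ε, -, hε⟩ := hε x
    exact Subtype.ext (Subbasis.unique_of_isLower B.2 B'.2 (fun i => (hε B i).2.2 (hx.2.1 i))
      fun i => (hε B' i).2.2 (hx'.2.1 i))

theorem exists_hstar_coneSlice (hv : Submodule.span ℝ (Set.range v) = ⊤) {h : E →ₗ[ℝ] ℝ}
    (hh : ∀ i, h (v i) = 1) {L : AddSubgroup E} (hL : ∀ i, v i ∈ L)
    (hfin : ∀ n, (coneSlice L h v n).Finite) :
    ∃ f : Polynomial ℤ, (∀ i, 0 ≤ f.coeff i) ∧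
      (1 - PowerSeries.X) ^ finrank ℝ E *
        PowerSeries.mk (fun n => ((coneSlice L h v n).ncard : ℤ)) =
      PowerSeries.mk (fun n => f.coeff n) := by
  classical
  obtain ⟨S, q, hS⟩ := exists_halfOpen_decomposition_s11 hv hh L
  have := Fintype.ofFinite S
  have := fun B : Subbasis v => Fintype.ofFinite B.1
  let A : ∀ B : S, Finset B.1.1 → ℕ → Set E := fun B => peeledSlice L h B.1.basis
    (fun i => LexPos (B.1.basis.coord i q))
  have hA : ∀ B n, (A B ∅ n).Finite := fun B n =>
    (hfin n).subset <| (hS n).1 ▸ Set.subset_iUnion (fun B => A B ∅ n) B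
  have hb1 : ∀ (B : S) i, h (B.1.basis i) = 1 := fun B i => by rw [B.1.basis_apply, hh]
  have hrank : ∀ B : S, Fintype.card B.1.1 = finrank ℝ E := fun B =>
    (finrank_eq_card_basis B.1.basis).symm
  have hcard : ∀ n, (coneSlice L h v n).ncard = ∑ B, (A B ∅ n).ncard := fun n => by
    rw [(hS n).1, Set.ncard_iUnion_of_finite (fun B => hA B n) (hS n).2, finsum_eq_sum_of_fintype]
  have hmul : ∀ B : S, (1 - PowerSeries.X) ^ finrank ℝ E *
      PowerSeries.mk (fun n => ((A B ∅ n).ncard : ℤ)) =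
      PowerSeries.mk (fun n => ((A B Finset.univ n).ncard : ℤ)) := fun B => by
    rw [← hrank B, ← Finset.card_univ]
    refine one_sub_X_pow_mul_peeledSlice (fun i => ?_) (hb1 B) ?_ ?_ (hA B) _
    · rw [B.1.basis_apply]
      exact hL i
    · rintro i a (ha | ha)
      exacts [ha.le, ha.1.ge]
    · rintro i a (ha | ha)
      exacts [Or.inl (by linarith), Or.inl (by linarith [ha.1])]
  have hzero : ∀ (B : S) n, finrank ℝ E < n → (A B Finset.univ n).ncard = 0 := fun B n hn => by
    have hempty : A B Finset.univ n = ∅ :=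
      peeledSlice_univ_eq_empty (hb1 B) (fun _ _ => Or.inl) ((hrank B).symm ▸ hn)
    rw [hempty, Set.ncard_empty]
  refine ⟨PowerSeries.trunc (finrank ℝ E + 1)
    (PowerSeries.mk fun n => ∑ B, ((A B Finset.univ n).ncard : ℤ)), fun i => ?_, ?_⟩
  · rw [PowerSeries.coeff_trunc]
    split_ifs
    · rw [PowerSeries.coeff_mk]
      positivity
    · rfl
  · have hsum : PowerSeries.mk (fun n => ((coneSlice L h v n).ncard : ℤ)) =
        ∑ B, PowerSeries.mk (fun n => ((A B ∅ n).ncard : ℤ)) := by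
      ext n
      simp [hcard]
    rw [hsum, Finset.mul_sum, Finset.sum_congr rfl fun B _ => hmul B]
    ext n
    simp only [map_sum, PowerSeries.coeff_mk, PowerSeries.coeff_trunc]
    split_ifs with hn
    · rfl
    · exact Finset.sum_eq_zero fun B _ => by rw [hzero B n (by omega), Nat.cast_zero]

end Decomposition

/-- The lattice `ℤ^d × ℤ` in `ℝ^d × ℝ`. -/
def homogenizedLattice (d : ℕ) : AddSubgroup ((Fin d → ℝ) × ℝ) :=
  (((Int.castAddHom ℝ).compLeft (Fin d)).prodMap (Int.castAddHom ℝ)).range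

lemma span_homogenization_eq_top {F ι : Type*} [AddCommGroup F] [Module ℝ F] {v : ι → F}
    (hv : affineSpan ℝ (Set.range v) = ⊤) :
    Submodule.span ℝ (Set.range fun i => (v i, (1 : ℝ))) = ⊤ := by
  set W := Submodule.span ℝ (Set.range fun i => (v i, (1 : ℝ)))
  have hle : affineSpan ℝ (Set.range v) ≤ W.toAffineSubspace.comap
      ((AffineMap.id ℝ F).prod (AffineMap.const ℝ F (1 : ℝ))) := by
    rw [affineSpan_le]
    rintro _ ⟨i, rfl⟩
    exact Submodule.subset_span ⟨i, rfl⟩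
  have hone : ∀ p : F, (p, (1 : ℝ)) ∈ W := fun p => hle (hv ▸ AffineSubspace.mem_top ℝ F p)
  rw [eq_top_iff]
  rintro ⟨p, t⟩ -
  have : (p, t) = ((p, 1) - (0, 1) : F × ℝ) + t • ((0, 1) : F × ℝ) := by simp
  rw [this]
  exact W.add_mem (W.sub_mem (hone p) (hone 0)) (W.smul_mem t (hone 0))

lemma mem_smul_convexHull_range_iff {F ι : Type*} [AddCommGroup F] [Module ℝ F] [Fintype ι]
    [Nonempty ι] (v : ι → F) {t : ℝ} (ht : 0 ≤ t) (x : F) :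
    x ∈ t • convexHull ℝ (Set.range v) ↔
      ∃ w : ι → ℝ, (∀ i, 0 ≤ w i) ∧ ∑ i, w i • (v i, (1 : ℝ)) = (x, t) := by
  classical
  have hpair : ∀ w : ι → ℝ, ∑ i, w i • (v i, (1 : ℝ)) = (∑ i, w i • v i, ∑ i, w i) := fun w => by
    ext <;> simp [Prod.fst_sum, Prod.snd_sum]
  have hhull : ∀ y, y ∈ convexHull ℝ (Set.range v) ↔
      ∃ w : ι → ℝ, (∀ i, 0 ≤ w i) ∧ ∑ i, w i = 1 ∧ ∑ i, w i • v i = y := fun y => by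
    constructor
    · rw [convexHull_range_eq_exists_affineCombination]
      rintro ⟨s, w, hw, hw1, rfl⟩
      refine ⟨fun i => if i ∈ s then w i else 0, fun i => ?_, ?_, ?_⟩
      · dsimp only
        split_ifs with hi
        exacts [hw i hi, le_rfl]
      · simpa using hw1
      · rw [Finset.affineCombination_eq_linear_combination _ _ _ hw1]
        simp
    · rintro ⟨w, hw, hw1, hwy⟩
      exact mem_convexHull_of_exists_fintype w v hw hw1 (fun i => ⟨i, rfl⟩) hwy
  simp only [hpair, Prod.mk.injEq]
  constructor
  · rintro ⟨y, hy, rfl⟩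
    obtain ⟨w, hw, hw1, rfl⟩ := (hhull y).1 hy
    exact ⟨fun i => t * w i, fun i => mul_nonneg ht (hw i),
      by simp [mul_smul, Finset.smul_sum], by rw [← Finset.mul_sum, hw1, mul_one]⟩
  · rintro ⟨w, hw, rfl, rfl⟩
    rcases ht.eq_or_lt with h0 | hpos
    · have hw0 : ∀ i, w i = 0 := fun i =>
        (Finset.sum_eq_zero_iff_of_nonneg fun i _ => hw i).1 h0.symm i (Finset.mem_univ i)
      obtain ⟨i⟩ := ‹Nonempty ι›
      exact ⟨v i, subset_convexHull ℝ _ ⟨i, rfl⟩, by simp [hw0]⟩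
    · refine ⟨∑ i, ((∑ j, w j)⁻¹ * w i) • v i, (hhull _).2 ⟨_, fun i => ?_, ?_, rfl⟩, ?_⟩
      · exact mul_nonneg (inv_nonneg.2 ht) (hw i)
      · rw [← Finset.mul_sum, inv_mul_cancel₀ hpos.ne']
      · simp only [mul_smul, ← Finset.smul_sum]
        exact smul_inv_smul₀ hpos.ne' _

lemma finite_intPoints_of_isBounded {d : ℕ} {s : Set (Fin d → ℝ)} (hs : Bornology.IsBounded s) :
    {α : Fin d → ℤ | (fun i => (α i : ℝ)) ∈ s}.Finite := by
  obtain ⟨r, hr⟩ := hs.exists_norm_le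
  refine (Set.finite_Icc (fun _ => -⌈r⌉ : Fin d → ℤ) (fun _ => ⌈r⌉)).subset fun α hα => ?_
  have h1 : ∀ i, |(α i : ℝ)| ≤ ⌈r⌉ := fun i =>
    (norm_le_pi_norm (fun i => (α i : ℝ)) i).trans ((hr _ hα).trans (Int.le_ceil r))
  exact ⟨fun i => by exact_mod_cast (abs_le.1 (h1 i)).1,
    fun i => by exact_mod_cast (abs_le.1 (h1 i)).2⟩

/-- for a full-dimensional lattice polytope `P ⊆ ℝ^d`, the
Ehrhart series satisfies `(1 − t)^{d+1} · ∑_{n≥0} |nP ∩ ℤ^d| tⁿ = h*(t)` for a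
polynomial `h*` with nonnegative integer coefficients. -/
theorem lattice_polytope_hstar_nonneg
    {d : ℕ} (P : Set (Fin d → ℝ))
    (hP : ∃ V : Finset (Fin d → ℤ),
      P = convexHull ℝ ((fun (x : Fin d → ℤ) => (fun i => (x i : ℝ))) '' (V : Set (Fin d → ℤ))))
    (hfull : affineSpan ℝ P = ⊤) :
    ∃ h : Polynomial ℤ, (∀ i, 0 ≤ h.coeff i) ∧
      (1 - PowerSeries.X) ^ (d + 1) *
        PowerSeries.mk (fun n =>
          (Nat.card {α : Fin d → ℤ // (fun i => (α i : ℝ)) ∈ (n : ℝ) • P} : ℤ))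
      = PowerSeries.mk (fun n => h.coeff n) := by
  classical
  obtain ⟨V, rfl⟩ := hP
  let u : V → Fin d → ℝ := fun x i => (x.1 i : ℝ)
  have himage : (fun (x : Fin d → ℤ) => (fun i => (x i : ℝ))) '' (V : Set (Fin d → ℤ)) =
      Set.range u := by
    rw [Set.image_eq_range]
    rfl
  rw [himage] at hfull ⊢
  rw [affineSpan_convexHull] at hfull
  have hne : Nonempty V := by
    by_contra hV
    rw [not_nonempty_iff] at hV
    rw [Set.range_eq_empty, AffineSubspace.span_empty] at hfull
    exact AffineSubspace.bot_ne_top ℝ (Fin d → ℝ) (Fin d → ℝ) hfull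
  let h : (Fin d → ℝ) × ℝ →ₗ[ℝ] ℝ := LinearMap.snd ℝ _ _
  let v : V → (Fin d → ℝ) × ℝ := fun i => (u i, 1)
  have hslice : ∀ n : ℕ, coneSlice (homogenizedLattice d) h v n =
      (fun α : Fin d → ℤ => ((fun i => (α i : ℝ)), (n : ℝ))) ''
        {α | (fun i => (α i : ℝ)) ∈ (n : ℝ) • convexHull ℝ (Set.range u)} := fun n => by
    ext x
    simp only [Set.mem_image, Set.mem_ofPred_eq,
      mem_smul_convexHull_range_iff u (Nat.cast_nonneg n)]
    constructor
    · rintro ⟨⟨⟨α, m⟩, rfl⟩, hw, hx⟩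
      have hx : (m : ℝ) = n := hx
      refine ⟨α, ?_, Prod.ext rfl hx.symm⟩
      rw [← hx]
      exact hw
    · rintro ⟨α, hw, rfl⟩
      exact ⟨⟨(α, n), by ext <;> simp⟩, hw, rfl⟩
  have hinj : ∀ n : ℕ, Function.Injective
      (fun α : Fin d → ℤ => ((fun i => (α i : ℝ)), (n : ℝ))) := fun n α β e => by
    funext i
    exact Int.cast_injective (congrFun (congrArg Prod.fst e) i)
  have hbdd : Bornology.IsBounded (convexHull ℝ (Set.range u)) :=
    ((Set.finite_range u).isCompact_convexHull ℝ).isBounded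
  obtain ⟨f, hf, hmul⟩ := exists_hstar_coneSlice (v := v) (h := h) (L := homogenizedLattice d)
    (span_homogenization_eq_top hfull) (fun _ => rfl)
    (fun i => ⟨(i.1, 1), by ext <;> simp [v, u]⟩)
    (fun n => hslice n ▸ (finite_intPoints_of_isBounded (hbdd.smul₀ (n : ℝ))).image _)
  refine ⟨f, hf, ?_⟩
  have hrank : finrank ℝ ((Fin d → ℝ) × ℝ) = d + 1 := by simp
  rw [hrank] at hmul
  simpa only [hslice, Set.ncard_image_of_injective _ (hinj _), ← Nat.card_coe_set_eq,
    Set.coe_ofPred] using hmul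
end

section
/- Let P ⊆ ℝ^d be a full-dimensional rational polytope and let q be a positive integer such that qP is a lattice polytope. Then there exists a polynomial h*(t) with nonnegative integer coefficients such that, in ℤ⟦t⟧, (1 − t^q)^{d+1} · ∑_{n ≥ 0} |nP ∩ ℤ^d| · t^n = h*(t). -/
open scoped Pointwise

namespace EhrhartCone

section Triangulation

variable {ι E : Type*} [AddCommGroup E] [Module ℝ E]

/-- The subfamily of `v` indexed by `B` is a basis of the ambient space. -/
structure IsBasisSet (v : ι → E) (B : Finset ι) : Prop where
  linearIndepOn : LinearIndepOn ℝ v (B : Set ι)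
  span_eq_top : Submodule.span ℝ (v '' (B : Set ι)) = ⊤

/-- The basis given by the subfamily of `v` indexed by `B`. -/
noncomputable def IsBasisSet.basis {v : ι → E} {B : Finset ι} (h : IsBasisSet v B) :
    Module.Basis B ℝ E :=
  Module.Basis.mk (v := fun i : B => v i) h.linearIndepOn
    (by
      rw [← h.span_eq_top, Set.image_eq_range]
      rfl)

lemma IsBasisSet.basis_apply {v : ι → E} {B : Finset ι} (h : IsBasisSet v B) (i : B) :
    h.basis i = v i := by
  exact Module.Basis.mk_apply _ _ i

open Classical in
/-- The `i`-th coordinate with respect to the basis indexed by `B`, and `0` if `i ∉ B` or if `B`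
does not index a basis. -/
noncomputable def coord (v : ι → E) (B : Finset ι) (i : ι) : E →ₗ[ℝ] ℝ :=
  if h : IsBasisSet v B ∧ i ∈ B then h.1.basis.coord ⟨i, h.2⟩ else 0

lemma coord_of_notMem (v : ι → E) {B : Finset ι} {i : ι} (hi : i ∉ B) : coord v B i = 0 := by
  simp [coord, hi]

namespace IsBasisSet

variable {v : ι → E} {B : Finset ι}

lemma coord_eq (h : IsBasisSet v B) (i : B) : coord v B i = h.basis.coord i := by
  simp [coord, h]

lemma card_eq (h : IsBasisSet v B) : B.card = Module.finrank ℝ E := by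
  simp [Module.finrank_eq_card_basis h.basis]

lemma coord_self (h : IsBasisSet v B) {i : ι} (hi : i ∈ B) : coord v B i (v i) = 1 := by
  have := h.basis_apply ⟨i, hi⟩
  simp only at this
  rw [h.coord_eq ⟨i, hi⟩, ← this]
  simp

lemma coord_ne (h : IsBasisSet v B) {i j : ι} (hj : j ∈ B) (hij : i ≠ j) :
    coord v B i (v j) = 0 := by
  by_cases hi : i ∈ B
  · have := h.basis_apply ⟨j, hj⟩
    simp only at this
    rw [h.coord_eq ⟨i, hi⟩, ← this]
    simp [hij.symm]
  · simp [coord_of_notMem v hi]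

lemma sum_coord_smul [Fintype ι] (h : IsBasisSet v B) (x : E) :
    ∑ i, coord v B i x • v i = x := by
  classical
  rw [← Finset.sum_subset (Finset.subset_univ B)
    (fun i _ hi => by simp [coord_of_notMem v hi]), ← Finset.sum_coe_sort]
  conv_rhs => rw [← h.basis.sum_repr x]
  exact Finset.sum_congr rfl fun i _ => by simp [h.coord_eq i, h.basis_apply]

end IsBasisSet

/-- A subfamily of a spanning family can be thinned out and then extended to a basis without
changing its span. -/
lemma exists_isBasisSet [Fintype ι] {v : ι → E} (hspan : Submodule.span ℝ (Set.range v) = ⊤)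
    (S : Finset ι) : ∃ B : Finset ι, IsBasisSet v B ∧
      ∀ j ∈ S, ∀ i ∉ S, coord v B i (v j) = 0 := by
  classical
  obtain ⟨T, hTS, -, hT, hTi⟩ := exists_linearIndepOn_extension (K := ℝ) (v := v)
    (linearIndepOn_empty ℝ v) (Set.empty_subset (S : Set ι))
  obtain ⟨U, -, hTU, hU, hUi⟩ := exists_linearIndepOn_extension hTi (Set.subset_univ T)
  have hB : IsBasisSet v U.toFinset := by
    refine ⟨by simpa using hUi, ?_⟩
    rw [eq_top_iff, ← hspan, Submodule.span_le]
    simpa using hU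
  refine ⟨U.toFinset, hB, fun j hj i hi => ?_⟩
  have hle : Submodule.span ℝ (v '' T) ≤ LinearMap.ker (coord v U.toFinset i) := by
    rw [Submodule.span_le]
    rintro _ ⟨k, hk, rfl⟩
    have hik : i ≠ k := by
      rintro rfl
      exact hi (by simpa using hTS hk)
    exact hB.coord_ne (by simpa using hTU hk) hik
  exact hle (hT ⟨j, by simpa using hj, rfl⟩)

variable [Fintype ι]

/-- The nonnegative combinations of the family `v`. -/
def cone (v : ι → E) : Set E :=
  {x | ∃ l : ι → ℝ, (∀ i, 0 ≤ l i) ∧ ∑ i, l i • v i = x}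

lemma IsBasisSet.mem_cone {v : ι → E} {B : Finset ι} (h : IsBasisSet v B) {x : E}
    (hx : ∀ i ∈ B, 0 ≤ coord v B i x) : x ∈ cone v := by
  refine ⟨fun i => coord v B i x, fun i => ?_, h.sum_coord_smul x⟩
  by_cases hi : i ∈ B
  · exact hx i hi
  · simp [coord_of_notMem v hi]

/-- Strict dual feasibility of a basis for the linear program with cost `c`: the vectors
outside `B` lie strictly above the hyperplane through the lifted vectors of `B`. -/
def IsLower (v : ι → E) (c : ι → ℝ) (B : Finset ι) : Prop :=
  ∀ j ∉ B, ∑ i, coord v B i (v j) * c i < c j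

lemma IsBasisSet.sum_coord_mul_of_mem {v : ι → E} {B : Finset ι} (h : IsBasisSet v B)
    (c : ι → ℝ) {j : ι} (hj : j ∈ B) : ∑ i, coord v B i (v j) * c i = c j := by
  classical
  rw [Finset.sum_eq_single j (fun i _ hij => by simp [h.coord_ne hj hij]) (by simp),
    h.coord_self hj, one_mul]

lemma IsBasisSet.cost_eq {v : ι → E} {B B' : Finset ι} (h' : IsBasisSet v B')
    (c : ι → ℝ) (z : E) : ∑ i, coord v B i z * c i =
      ∑ j, coord v B' j z * ∑ i, coord v B i (v j) * c i := by
  simp_rw [Finset.mul_sum]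
  rw [Finset.sum_comm]
  refine Finset.sum_congr rfl fun i _ => ?_
  conv_lhs => rw [← h'.sum_coord_smul z]
  simp [Finset.sum_mul, mul_assoc]

lemma IsLower.subset_of_cost_le {v : ι → E} {c : ι → ℝ} {B B' : Finset ι} (h : IsBasisSet v B)
    (h' : IsBasisSet v B') (hl : IsLower v c B) {z : E} (hz' : ∀ i ∈ B', 0 < coord v B' i z)
    (hcost : ∑ i, coord v B' i z * c i ≤ ∑ i, coord v B i z * c i) : B' ⊆ B := by
  by_contra hsub
  obtain ⟨j, hj', hj⟩ := Finset.not_subset.1 hsub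
  refine hcost.not_gt ?_
  rw [h'.cost_eq (B := B)]
  refine Finset.sum_lt_sum (fun k _ => ?_)
    ⟨j, Finset.mem_univ j, mul_lt_mul_of_pos_left (hl j hj) (hz' j hj')⟩
  by_cases hk' : k ∈ B'
  · refine mul_le_mul_of_nonneg_left ?_ (hz' k hk').le
    by_cases hk : k ∈ B
    · exact (h.sum_coord_mul_of_mem c hk).le
    · exact (hl k hk).le
  · simp [coord_of_notMem v hk']

lemma IsLower.eq_of_pos {v : ι → E} {c : ι → ℝ} {B B' : Finset ι} (h : IsBasisSet v B)
    (h' : IsBasisSet v B') (hl : IsLower v c B) (hl' : IsLower v c B') {z : E}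
    (hz : ∀ i ∈ B, 0 < coord v B i z) (hz' : ∀ i ∈ B', 0 < coord v B' i z) : B = B' := by
  wlog hcost : ∑ i, coord v B' i z * c i ≤ ∑ i, coord v B i z * c i generalizing B B'
  · exact (this h' h hl' hl hz' hz (le_of_not_ge hcost)).symm
  have hsub := hl.subset_of_cost_le h h' hz' hcost
  exact (Finset.eq_of_subset_of_card_le hsub (by rw [h.card_eq, h'.card_eq])).symm

end Triangulation

section Existence

variable {ι E : Type*} [Fintype ι] [NormedAddCommGroup E] [NormedSpace ℝ E]

/-- A linear program over the representations of a point of a cone has a minimizer. -/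
lemma exists_minimal_representation {v : ι → E} (ht : E →ₗ[ℝ] ℝ) (hpos : ∀ i, 0 < ht (v i))
    (c : ι → ℝ) {z : E} (hz : z ∈ cone v) :
    ∃ l : ι → ℝ, (∀ i, 0 ≤ l i) ∧ ∑ i, l i • v i = z ∧
      ∀ l' : ι → ℝ, (∀ i, 0 ≤ l' i) → ∑ i, l' i • v i = z →
        ∑ i, l i * c i ≤ ∑ i, l' i * c i := by
  have hcl : IsClosed {l : ι → ℝ | (∀ i, 0 ≤ l i) ∧ ∑ i, l i • v i = z} := by
    refine IsClosed.inter ?_ (isClosed_eq (by fun_prop) continuous_const)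
    change IsClosed {l : ι → ℝ | ∀ i, 0 ≤ l i}
    simp only [Set.ofPred_forall]
    exact isClosed_iInter fun i => isClosed_le continuous_const (continuous_apply i)
  have hK : IsCompact {l : ι → ℝ | (∀ i, 0 ≤ l i) ∧ ∑ i, l i • v i = z} := by
    refine (isCompact_Icc (a := (0 : ι → ℝ)) (b := fun i => ht z / ht (v i))).of_isClosed_subset
      hcl ?_
    rintro l ⟨hl, hlz⟩
    refine ⟨hl, fun i => ?_⟩
    rw [le_div_iff₀ (hpos i), ← hlz]
    simp only [map_sum, map_smul, smul_eq_mul]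
    exact Finset.single_le_sum (f := fun i => l i * ht (v i))
      (fun j _ => mul_nonneg (hl j) (hpos j).le) (Finset.mem_univ i)
  obtain ⟨l, hl, hmin⟩ := hK.exists_isMinOn hz
    (f := fun l : ι → ℝ => ∑ i, l i * c i) (by fun_prop)
  exact ⟨l, hl.1, hl.2, fun l' h h' => hmin ⟨h, h'⟩⟩

/-- Feasible directions at a minimizer do not decrease the cost. -/
lemma cost_nonneg_of_minimal {v : ι → E} {c l : ι → ℝ} (hl : ∀ i, 0 ≤ l i)
    (hmin : ∀ l' : ι → ℝ, (∀ i, 0 ≤ l' i) → ∑ i, l' i • v i = ∑ i, l i • v i →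
        ∑ i, l i * c i ≤ ∑ i, l' i * c i)
    {r : ι → ℝ} (hr : ∑ i, r i • v i = 0) (hr0 : ∀ i, l i = 0 → 0 ≤ r i) :
    0 ≤ ∑ i, r i * c i := by
  have hev : ∀ᶠ ε : ℝ in nhdsWithin 0 (Set.Ioi 0), ∀ i, 0 ≤ l i + ε * r i := by
    rw [Filter.eventually_all]
    intro i
    rcases (hl i).eq_or_lt with h | h
    · filter_upwards [self_mem_nhdsWithin] with ε hε
      rw [← h, zero_add]
      exact mul_nonneg (le_of_lt hε) (hr0 i h.symm)
    · have hc : Filter.Tendsto (fun ε : ℝ => l i + ε * r i) (nhdsWithin 0 (Set.Ioi 0))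
          (nhds (l i)) := by
        have : ContinuousAt (fun ε : ℝ => l i + ε * r i) 0 := by fun_prop
        simpa [ContinuousAt] using this.mono_left nhdsWithin_le_nhds
      filter_upwards [hc.eventually (lt_mem_nhds h)] with ε hε using hε.le
  obtain ⟨ε, hε, hε0⟩ := (hev.and self_mem_nhdsWithin).exists
  have := hmin (fun i => l i + ε * r i) hε (by
    simp [add_smul, Finset.sum_add_distrib, mul_smul, ← Finset.smul_sum, hr])
  simp only [add_mul, Finset.sum_add_distrib, mul_assoc, ← Finset.mul_sum] at this
  exact nonneg_of_mul_nonneg_right (by linarith) hε0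

/-- For generic costs, every generic point of the cone lies in the interior of a simplicial cone
belonging to the lower envelope. -/
lemma exists_isLower {v : ι → E} (hspan : Submodule.span ℝ (Set.range v) = ⊤)
    (ht : E →ₗ[ℝ] ℝ) (hpos : ∀ i, 0 < ht (v i)) {c : ι → ℝ}
    (hc : ∀ B, IsBasisSet v B → ∀ j ∉ B, ∑ i, coord v B i (v j) * c i ≠ c j)
    {z : E} (hz : z ∈ cone v) (hz0 : ∀ B, IsBasisSet v B → ∀ i ∈ B, coord v B i z ≠ 0) :
    ∃ B, IsBasisSet v B ∧ IsLower v c B ∧ ∀ i ∈ B, 0 < coord v B i z := by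
  classical
  obtain ⟨l, hl, hlz, hmin⟩ := exists_minimal_representation ht hpos c hz
  rw [← hlz] at hmin
  obtain ⟨B, hB, hBS⟩ := exists_isBasisSet hspan (Finset.univ.filter fun i => l i ≠ 0)
  simp only [Finset.mem_filter, Finset.mem_univ, true_and, not_not] at hBS
  have hBl : ∀ i ∈ B, l i ≠ 0 := by
    intro i hi h0
    refine hz0 B hB i hi ?_
    rw [← hlz, map_sum]
    refine Finset.sum_eq_zero fun j _ => ?_
    by_cases hj : l j = 0
    · simp [hj]
    · simp [hBS j hj i h0]
  have hr : ∀ j, ∑ i, ((Pi.single j 1 : ι → ℝ) i - coord v B i (v j)) • v i = 0 := by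
    intro j
    simp [sub_smul, Finset.sum_sub_distrib, hB.sum_coord_smul, Pi.single_apply, ite_smul]
  have hrc : ∀ j, ∑ i, ((Pi.single j 1 : ι → ℝ) i - coord v B i (v j)) * c i
      = c j - ∑ i, coord v B i (v j) * c i := by
    intro j
    simp [sub_mul, Finset.sum_sub_distrib, Pi.single_apply]
  have hcoord0 : ∀ i j, l i = 0 → coord v B i (v j) = 0 := fun i j hi => by
    have : i ∉ B := fun h => hBl i h hi
    simp [coord_of_notMem v this]
  have hlow : IsLower v c B := by
    intro j hj
    refine lt_of_le_of_ne ?_ (hc B hB j hj)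
    have := cost_nonneg_of_minimal hl hmin (hr j) fun i hi => by
      rw [hcoord0 i j hi, sub_zero]
      exact Pi.single_nonneg (α := fun _ => ℝ) |>.2 zero_le_one i
    rw [hrc] at this
    linarith
  have hlB : ∀ j, j ∉ B → l j = 0 := by
    intro j hj
    by_contra hlj
    have := cost_nonneg_of_minimal (r := fun i => -((Pi.single j 1 : ι → ℝ) i - coord v B i (v j)))
      hl hmin (by simpa only [neg_smul, Finset.sum_neg_distrib, neg_eq_zero] using hr j)
      fun i hi => by
        have : i ≠ j := by
          rintro rfl
          exact hlj hi
        simp [hcoord0 i j hi, this]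
    simp only [neg_mul, Finset.sum_neg_distrib] at this
    rw [hrc] at this
    linarith [hlow j hj]
  refine ⟨B, hB, hlow, fun i hi => ?_⟩
  have : coord v B i z = l i := by
    rw [← hlz, map_sum, Finset.sum_eq_single i]
    · simp [hB.coord_self hi]
    · intro j _ hji
      by_cases hj : j ∈ B
      · simp [hB.coord_ne hj hji.symm]
      · simp [hlB j hj]
    · simp
  rw [this]
  exact lt_of_le_of_ne (hl i) (hBl i hi).symm

end Existence

section HalfOpen

/-- The half-line `[0, ∞)` if `s` holds and `(0, ∞)` otherwise. -/
def HalfOpenPos (s : Prop) (r : ℝ) : Prop := 0 < r ∨ (r = 0 ∧ s)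

lemma HalfOpenPos.nonneg {s : Prop} {r : ℝ} (h : HalfOpenPos s r) : 0 ≤ r := by
  rcases h with h | ⟨h, -⟩
  exacts [h.le, h.ge]

/-- The sign of `a + ε * b` for infinitesimal `ε > 0`. -/
lemma eventually_pos_iff_halfOpenPos (a : ℝ) {b : ℝ} (hb : b ≠ 0) :
    ∀ᶠ ε : ℝ in nhdsWithin 0 (Set.Ioi 0),
      a + ε * b ≠ 0 ∧ (0 < a + ε * b ↔ HalfOpenPos (0 < b) a) := by
  have hlim : Filter.Tendsto (fun ε : ℝ => a + ε * b) (nhdsWithin 0 (Set.Ioi 0)) (nhds a) := by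
    have : ContinuousAt (fun ε : ℝ => a + ε * b) 0 := by fun_prop
    simpa [ContinuousAt] using this.mono_left nhdsWithin_le_nhds
  rcases lt_trichotomy a 0 with ha | rfl | ha
  · filter_upwards [hlim.eventually (gt_mem_nhds ha)] with ε hε
    exact ⟨hε.ne, iff_of_false hε.not_gt (by rintro (h | h) <;> linarith)⟩
  · filter_upwards [self_mem_nhdsWithin] with ε hε
    have hε' : 0 < ε := hε
    simp [HalfOpenPos, hε', hε'.ne', hb]
  · filter_upwards [hlim.eventually (lt_mem_nhds ha)] with ε hε
    exact ⟨hε.ne', iff_of_true hε (Or.inl ha)⟩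

variable {E : Type*} [NormedAddCommGroup E] [NormedSpace ℝ E]

/-- A positive parameter `t` for which both the costs `tⁱ` and the point `∑ tⁱ vᵢ` are generic. -/
lemma exists_generic_parameter {m : ℕ} (v : Fin m → E) :
    ∃ t : ℝ, 0 < t ∧
      (∀ B, IsBasisSet v B → ∀ j ∉ B, ∑ i, coord v B i (v j) * t ^ (i : ℕ) ≠ t ^ (j : ℕ)) ∧
      ∀ B, IsBasisSet v B → ∀ i ∈ B, coord v B i (∑ j : Fin m, t ^ (j : ℕ) • v j) ≠ 0 := by
  have h1 : ∀ᶠ t : ℝ in Filter.atTop, ∀ B, ∀ j, IsBasisSet v B → j ∉ B →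
      ∑ i, coord v B i (v j) * t ^ (i : ℕ) ≠ t ^ (j : ℕ) := by
    simp only [Filter.eventually_all]
    intro B j hB hj
    set p : Polynomial ℝ := ∑ i : Fin m, Polynomial.C (coord v B i (v j)) *
      Polynomial.X ^ (i : ℕ) - Polynomial.X ^ (j : ℕ) with hp
    have hp0 : p ≠ 0 := by
      intro h
      have := congrArg (fun r => r.coeff (j : ℕ)) h
      simp [hp, Polynomial.coeff_X_pow, Fin.val_inj, coord_of_notMem v hj] at this
    filter_upwards [p.eventually_atTop_not_isRoot hp0] with t ht heq
    exact ht (by simp [hp, Polynomial.IsRoot, Polynomial.eval_finsetSum, heq])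
  have h2 : ∀ᶠ t : ℝ in Filter.atTop, ∀ B, ∀ i, IsBasisSet v B → i ∈ B →
      coord v B i (∑ j : Fin m, t ^ (j : ℕ) • v j) ≠ 0 := by
    simp only [Filter.eventually_all]
    intro B i hB hi
    set p : Polynomial ℝ := ∑ j : Fin m, Polynomial.C (coord v B i (v j)) *
      Polynomial.X ^ (j : ℕ) with hp
    have hp0 : p ≠ 0 := by
      intro h
      have := congrArg (fun r => r.coeff (i : ℕ)) h
      simp [hp, Polynomial.coeff_X_pow, Fin.val_inj, hB.coord_self hi] at this
    filter_upwards [p.eventually_atTop_not_isRoot hp0] with t ht heq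
    refine ht ?_
    refine Eq.trans ?_ heq
    rw [hp, Polynomial.eval_finsetSum, map_sum]
    refine Finset.sum_congr rfl fun j _ => ?_
    rw [map_smul, smul_eq_mul, Polynomial.eval_mul, Polynomial.eval_C, Polynomial.eval_pow,
      Polynomial.eval_X, mul_comm]
  obtain ⟨t, ⟨h1, h2⟩, h0⟩ := ((h1.and h2).and (Filter.eventually_gt_atTop (0 : ℝ))).exists
  exact ⟨t, h0, fun B hB j hj => h1 B j hB hj, fun B hB i hi => h2 B i hB hi⟩

/-- A spanning cone contained in an open half-space is a disjoint union of half-open simplicial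
cones spanned by some of its generators. -/
theorem exists_halfOpen_decomposition {m : ℕ} {v : Fin m → E}
    (hspan : Submodule.span ℝ (Set.range v) = ⊤)
    (ht : E →ₗ[ℝ] ℝ) (hpos : ∀ i, 0 < ht (v i)) :
    ∃ (𝓑 : Finset (Finset (Fin m))) (s : Finset (Fin m) → Fin m → Prop),
      (∀ B ∈ 𝓑, IsBasisSet v B) ∧ ∀ x ∈ cone v,
        ∃! B, B ∈ 𝓑 ∧ ∀ i ∈ B, HalfOpenPos (s B i) (coord v B i x) := by
  classical
  obtain ⟨t, ht0, hc, hy⟩ := exists_generic_parameter v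
  set y := ∑ j : Fin m, t ^ (j : ℕ) • v j with hydef
  set c : Fin m → ℝ := fun i => t ^ (i : ℕ)
  refine ⟨Finset.univ.filter fun B => IsBasisSet v B ∧ IsLower v c B,
    fun B i => 0 < coord v B i y, fun B hB => (Finset.mem_filter.1 hB).2.1, ?_⟩
  intro x ⟨l, hl, hlx⟩
  have hev : ∀ᶠ ε : ℝ in nhdsWithin 0 (Set.Ioi 0), ∀ B, ∀ i, IsBasisSet v B → i ∈ B →
      coord v B i (x + ε • y) ≠ 0 ∧ (0 < coord v B i (x + ε • y) ↔
        HalfOpenPos (0 < coord v B i y) (coord v B i x)) := by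
    simp only [Filter.eventually_all, map_add, map_smul, smul_eq_mul]
    exact fun B i hB hi => eventually_pos_iff_halfOpenPos _ (hy B hB i hi)
  obtain ⟨ε, hε, hε0 : 0 < ε⟩ := (hev.and self_mem_nhdsWithin).exists
  have hz : x + ε • y ∈ cone v := by
    refine ⟨fun i => l i + ε * t ^ (i : ℕ), fun i => add_nonneg (hl i) (by positivity), ?_⟩
    simp [add_smul, Finset.sum_add_distrib, mul_smul, ← Finset.smul_sum, hlx, hydef]
  obtain ⟨B, hB, hBl, hBz⟩ := exists_isLower hspan ht hpos hc hz
    fun B hB i hi => (hε B i hB hi).1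
  refine ⟨B, ⟨Finset.mem_filter.2 ⟨Finset.mem_univ B, hB, hBl⟩, fun i hi => (hε B i hB hi).2.1 (hBz i hi)⟩, ?_⟩
  rintro B' ⟨hB', hBs'⟩
  obtain ⟨hB', hBl'⟩ := (Finset.mem_filter.1 hB').2
  exact hBl'.eq_of_pos hB' hB hBl (fun i hi => (hε B' i hB' hi).2.2 (hBs' i hi)) hBz

end HalfOpen

section Counting

variable {d : ℕ}

/-- The lattice point `(α, n)` of `ℝ^d × ℝ`. -/
def latticePoint (α : Fin d → ℤ) (n : ℕ) : (Fin d → ℝ) × ℝ := (fun i => (α i : ℝ), (n : ℝ))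

/-- The number of lattice points of `S` at height `n`. -/
noncomputable def latticeCount (S : Set ((Fin d → ℝ) × ℝ)) (n : ℕ) : ℕ :=
  {α : Fin d → ℤ | latticePoint α n ∈ S}.ncard

lemma latticePoint_add (α β : Fin d → ℤ) (n k : ℕ) :
    latticePoint (α + β) (n + k) = latticePoint α n + latticePoint β k := by
  ext <;> simp [latticePoint]

variable {m q : ℕ} {w : Fin m → Fin d → ℤ}

/-- The cone has finitely many lattice points at each height. -/
lemma finite_latticePoint_mem_cone (hq : 0 < q) (n : ℕ) :
    {α : Fin d → ℤ | latticePoint α n ∈ cone fun i => latticePoint (w i) q}.Finite := by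
  refine (Set.finite_Icc (fun k => -∑ i, (n : ℤ) * |w i k|)
    (fun k => ∑ i, (n : ℤ) * |w i k|)).subset ?_
  rintro α ⟨l, hl, hlα⟩
  have hn : ∑ i, l i * (q : ℝ) = n := by
    simpa [latticePoint, Prod.snd_sum] using congrArg Prod.snd hlα
  have hln : ∀ i, l i ≤ n := fun i => by
    rw [← hn]
    calc l i ≤ l i * (q : ℝ) := le_mul_of_one_le_right (hl i) (by exact_mod_cast hq)
      _ ≤ _ := Finset.single_le_sum (f := fun i => l i * (q : ℝ))
        (fun j _ => mul_nonneg (hl j) (Nat.cast_nonneg q)) (Finset.mem_univ i)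
  have habs : ∀ k, |α k| ≤ ∑ i, (n : ℤ) * |w i k| := fun k => by
    have hk : ∑ i, l i * (w i k : ℝ) = α k := by
      simpa [latticePoint, Prod.fst_sum] using congrFun (congrArg Prod.fst hlα) k
    have : |(α k : ℝ)| ≤ ∑ i, (n : ℝ) * |(w i k : ℝ)| := by
      rw [← hk]
      refine (Finset.abs_sum_le_sum_abs _ _).trans (Finset.sum_le_sum fun i _ => ?_)
      rw [abs_mul, abs_of_nonneg (hl i)]
      exact mul_le_mul_of_nonneg_right (hln i) (abs_nonneg _)
    exact_mod_cast this
  exact ⟨fun k => (abs_le.1 (habs k)).1, fun k => (abs_le.1 (habs k)).2⟩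

/-- The points of the half-open simplicial cone over `B` whose coordinates along `J` lie in a
half-open unit interval. -/
def halfOpenBox {E : Type*} [AddCommGroup E] [Module ℝ E] (v : Fin m → E) (B : Finset (Fin m))
    (s : Fin m → Prop) (J : Finset (Fin m)) : Set E :=
  {x | ∀ i ∈ B, HalfOpenPos (s i) (coord v B i x) ∧
    (i ∈ J → ¬ HalfOpenPos (s i) (coord v B i x - 1))}

lemma IsBasisSet.halfOpenBox_subset_cone {E : Type*} [AddCommGroup E] [Module ℝ E]
    {v : Fin m → E} {B : Finset (Fin m)} (h : IsBasisSet v B) (s : Fin m → Prop)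
    (J : Finset (Fin m)) : halfOpenBox v B s J ⊆ cone v :=
  fun _ hx => h.mem_cone fun i hi => (hx i hi).1.nonneg

lemma IsBasisSet.add_mem_halfOpenBox_iff {E : Type*} [AddCommGroup E] [Module ℝ E]
    {v : Fin m → E} {B : Finset (Fin m)} (h : IsBasisSet v B) (s : Fin m → Prop)
    {J : Finset (Fin m)} {i : Fin m} (hi : i ∈ B) (hiJ : i ∉ J) (x : E) :
    x ∈ halfOpenBox v B s J ↔
      x + v i ∈ halfOpenBox v B s J ∧ x + v i ∉ halfOpenBox v B s (insert i J) := by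
  have hself : coord v B i (x + v i) = coord v B i x + 1 := by simp [h.coord_self hi]
  have hne : ∀ j, j ≠ i → coord v B j (x + v i) = coord v B j x := fun j hj => by
    simp [h.coord_ne hi hj]
  constructor
  · intro hx
    refine ⟨fun j hj => ?_, fun hx' => ?_⟩
    · rcases eq_or_ne j i with rfl | hji
      · rw [hself]
        exact ⟨Or.inl (by linarith [(hx j hj).1.nonneg]), fun hJ => absurd hJ hiJ⟩
      · rw [hne j hji]
        exact hx j hj
    · refine (hx' i hi).2 (Finset.mem_insert_self i J) ?_
      rw [hself, add_sub_cancel_right]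
      exact (hx i hi).1
  · rintro ⟨hx, hx'⟩ j hj
    rcases eq_or_ne j i with rfl | hji
    · refine ⟨?_, fun hJ => absurd hJ hiJ⟩
      by_contra hcon
      refine hx' fun k hk => ⟨(hx k hk).1, fun hkJ => ?_⟩
      rcases Finset.mem_insert.1 hkJ with rfl | hkJ
      · rwa [hself, add_sub_cancel_right]
      · exact (hx k hk).2 hkJ
    · rw [← hne j hji]
      exact hx j hj

lemma halfOpenBox_insert_subset {E : Type*} [AddCommGroup E] [Module ℝ E] (v : Fin m → E)
    (B : Finset (Fin m)) (s : Fin m → Prop) (J : Finset (Fin m)) (i : Fin m) :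
    halfOpenBox v B s (insert i J) ⊆ halfOpenBox v B s J :=
  fun _ hx j hj => ⟨(hx j hj).1, fun hJ => (hx j hj).2 (Finset.mem_insert_of_mem hJ)⟩

lemma height_eq_sum_coord {B : Finset (Fin m)}
    (h : IsBasisSet (fun i => latticePoint (w i) q) B) (x : (Fin d → ℝ) × ℝ) :
    x.2 = ∑ i ∈ B, coord (fun i => latticePoint (w i) q) B i x * q := by
  conv_lhs => rw [← h.sum_coord_smul x]
  rw [Prod.snd_sum, ← Finset.sum_subset (Finset.subset_univ B)
    (fun i _ hi => by simp [coord_of_notMem _ hi])]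
  rfl

variable (w) in
/-- Removing the translate by a generator. -/
lemma latticeCount_halfOpenBox (hq : 0 < q) {B : Finset (Fin m)}
    (h : IsBasisSet (fun i => latticePoint (w i) q) B) (s : Fin m → Prop)
    {J : Finset (Fin m)} {i : Fin m} (hi : i ∈ B) (hiJ : i ∉ J) (n : ℕ) :
    latticeCount (halfOpenBox (fun i => latticePoint (w i) q) B s J) n =
      latticeCount (halfOpenBox (fun i => latticePoint (w i) q) B s (insert i J)) n +
        if q ≤ n then latticeCount (halfOpenBox (fun i => latticePoint (w i) q) B s J) (n - q)
          else 0 := by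
  set v : Fin m → (Fin d → ℝ) × ℝ := fun i => latticePoint (w i) q with hv
  have hfin : {α : Fin d → ℤ | latticePoint α n ∈ halfOpenBox v B s J}.Finite :=
    (finite_latticePoint_mem_cone hq n).subset fun α hα => h.halfOpenBox_subset_cone s J hα
  have hsub : {α : Fin d → ℤ | latticePoint α n ∈ halfOpenBox v B s (insert i J)} ⊆
      {α | latticePoint α n ∈ halfOpenBox v B s J} :=
    fun α hα => halfOpenBox_insert_subset v B s J i hα
  have key : ({α : Fin d → ℤ | latticePoint α n ∈ halfOpenBox v B s J} \
      {α | latticePoint α n ∈ halfOpenBox v B s (insert i J)}).ncard =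
      if q ≤ n then latticeCount (halfOpenBox v B s J) (n - q) else 0 := by
    split_ifs with hqn
    · rw [latticeCount, ← Set.ncard_image_of_injective
        {α : Fin d → ℤ | latticePoint α (n - q) ∈ halfOpenBox v B s J}
        (add_left_injective (w i))]
      congr 1
      have hadd : ∀ β : Fin d → ℤ,
          latticePoint (β + w i) n = latticePoint β (n - q) + v i := fun β => by
        rw [hv, ← latticePoint_add, Nat.sub_add_cancel hqn]
      ext α
      simp only [Set.mem_sdiff, Set.mem_image]
      constructor
      · intro hα
        refine ⟨α - w i, ?_, sub_add_cancel α (w i)⟩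
        refine (h.add_mem_halfOpenBox_iff s hi hiJ _).2 ?_
        rw [← hadd, sub_add_cancel]
        exact hα
      · rintro ⟨β, hβ, rfl⟩
        have := (h.add_mem_halfOpenBox_iff s hi hiJ _).1 hβ
        rwa [← hadd] at this
    · rw [Set.ncard_eq_zero (hfin.subset Set.sdiff_subset), Set.eq_empty_iff_forall_notMem]
      intro α hα
      have hmem : latticePoint α n - v i ∈ halfOpenBox v B s J :=
        (h.add_mem_halfOpenBox_iff s hi hiJ _).2 (by rw [sub_add_cancel]; exact hα)
      have hh := height_eq_sum_coord h (latticePoint α n - v i)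
      have h0 : 0 ≤ ∑ k ∈ B, coord v B k (latticePoint α n - v i) * (q : ℝ) :=
        Finset.sum_nonneg fun k hk => mul_nonneg (hmem k hk).1.nonneg (Nat.cast_nonneg q)
      rw [← hh] at h0
      simp only [hv, latticePoint, Prod.snd_sub, sub_nonneg, Nat.cast_le] at h0
      exact hqn h0
  rw [← key, add_comm]
  exact (Set.ncard_sdiff_add_ncard_of_subset hsub hfin).symm

variable (w) in
/-- Lattice points of a half-open box have bounded height. -/
lemma latticeCount_halfOpenBox_eq_zero {B : Finset (Fin m)}
    (h : IsBasisSet (fun i => latticePoint (w i) q) B) (s : Fin m → Prop) {n : ℕ}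
    (hn : B.card * q < n) :
    latticeCount (halfOpenBox (fun i => latticePoint (w i) q) B s B) n = 0 := by
  have : {α : Fin d → ℤ | latticePoint α n ∈
      halfOpenBox (fun i => latticePoint (w i) q) B s B} = ∅ := by
    rw [Set.eq_empty_iff_forall_notMem]
    intro α hα
    have hh := height_eq_sum_coord h (latticePoint α n)
    have hle : ∑ i ∈ B, coord (fun i => latticePoint (w i) q) B i (latticePoint α n) * (q : ℝ) ≤
        ∑ i ∈ B, (q : ℝ) := by
      refine Finset.sum_le_sum fun i hi => mul_le_of_le_one_left (Nat.cast_nonneg q) ?_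
      by_contra! hcon
      exact (hα i hi).2 hi (Or.inl (by linarith))
    rw [← hh] at hle
    simp only [latticePoint, Finset.sum_const, nsmul_eq_mul] at hle
    exact hn.not_ge (by exact_mod_cast hle)
  rw [latticeCount, this, Set.ncard_empty]

variable (w) in
/-- The generating function of a half-open simplicial cone. -/
lemma halfOpenBox_series (hq : 0 < q) {B : Finset (Fin m)}
    (h : IsBasisSet (fun i => latticePoint (w i) q) B) (s : Fin m → Prop)
    (J : Finset (Fin m)) (hJ : J ⊆ B) :
    (1 - PowerSeries.X ^ q) ^ J.card * PowerSeries.mk (fun n =>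
      (latticeCount (halfOpenBox (fun i => latticePoint (w i) q) B s ∅) n : ℤ)) =
    PowerSeries.mk (fun n =>
      (latticeCount (halfOpenBox (fun i => latticePoint (w i) q) B s J) n : ℤ)) := by
  induction J using Finset.induction_on with
  | empty => simp
  | insert i J hi ih =>
    rw [Finset.card_insert_of_notMem hi, pow_succ', mul_assoc,
      ih ((Finset.subset_insert i J).trans hJ)]
    ext n
    rw [sub_mul, one_mul, map_sub, PowerSeries.coeff_X_pow_mul']
    simp only [PowerSeries.coeff_mk]
    rw [latticeCount_halfOpenBox w hq h s (hJ (Finset.mem_insert_self i J)) hi n]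
    split_ifs <;> simp

/-- The lattice point series of a full-dimensional cone with generators at height `q`. -/
theorem cone_series (hq : 0 < q)
    (hspan : Submodule.span ℝ (Set.range fun i => latticePoint (w i) q) = ⊤) :
    ∃ h : Polynomial ℤ, (∀ i, 0 ≤ h.coeff i) ∧
      (1 - PowerSeries.X ^ q) ^ (d + 1) * PowerSeries.mk (fun n =>
        (latticeCount (cone fun i => latticePoint (w i) q) n : ℤ)) =
      PowerSeries.mk (fun n => h.coeff n) := by
  classical
  set v : Fin m → (Fin d → ℝ) × ℝ := fun i => latticePoint (w i) q with hv
  obtain ⟨𝓑, s, h𝓑, huniq⟩ := exists_halfOpen_decomposition hspan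
    (LinearMap.snd ℝ (Fin d → ℝ) ℝ) (fun i => by simpa [hv, latticePoint] using hq)
  have hcard : ∀ B ∈ 𝓑, B.card = d + 1 := fun B hB => by
    rw [(h𝓑 B hB).card_eq]
    simp
  have hcount : ∀ n, latticeCount (cone v) n =
      ∑ B ∈ 𝓑, latticeCount (halfOpenBox v B (s B) ∅) n := by
    intro n
    have hfin : ∀ B ∈ (𝓑 : Set (Finset (Fin m))),
        {α : Fin d → ℤ | latticePoint α n ∈ halfOpenBox v B (s B) ∅}.Finite := fun B hB =>
      (finite_latticePoint_mem_cone hq n).subset fun α hα =>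
        (h𝓑 B hB).halfOpenBox_subset_cone (s B) ∅ hα
    have hdisj : (𝓑 : Set (Finset (Fin m))).PairwiseDisjoint fun B =>
        {α : Fin d → ℤ | latticePoint α n ∈ halfOpenBox v B (s B) ∅} := by
      intro B hB B' hB' hne
      refine Set.disjoint_left.2 fun α hα hα' => hne ?_
      exact (huniq _ ((h𝓑 B hB).halfOpenBox_subset_cone (s B) ∅ hα)).unique
        ⟨hB, fun i hi => (hα i hi).1⟩ ⟨hB', fun i hi => (hα' i hi).1⟩
    have hU := Set.Finite.ncard_biUnion 𝓑.finite_toSet hfin hdisj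
    simp only [Finset.mem_coe, finsum_mem_finset_eq_sum] at hU
    simp only [latticeCount]
    rw [← hU]
    congr 1
    ext α
    simp only [Set.mem_iUnion]
    constructor
    · intro hα
      obtain ⟨B, ⟨hB, hs⟩, -⟩ := huniq _ hα
      exact ⟨B, hB, fun i hi => ⟨hs i hi, by simp⟩⟩
    · rintro ⟨B, hB, hα⟩
      exact (h𝓑 B hB).halfOpenBox_subset_cone (s B) ∅ hα
  set f : PowerSeries ℤ := ∑ B ∈ 𝓑,
    PowerSeries.mk (fun n => (latticeCount (halfOpenBox v B (s B) B) n : ℤ)) with hf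
  have hcoeff : ∀ n, PowerSeries.coeff n f =
      ∑ B ∈ 𝓑, (latticeCount (halfOpenBox v B (s B) B) n : ℤ) := fun n => by
    simp [hf]
  refine ⟨PowerSeries.trunc ((d + 1) * q + 1) f, fun n => ?_, ?_⟩
  · rw [PowerSeries.coeff_trunc]
    split_ifs
    · rw [hcoeff]
      exact Finset.sum_nonneg fun B _ => Int.natCast_nonneg _
    · exact le_rfl
  · have hsum : PowerSeries.mk (fun n => (latticeCount (cone v) n : ℤ)) = ∑ B ∈ 𝓑,
        PowerSeries.mk (fun n => (latticeCount (halfOpenBox v B (s B) ∅) n : ℤ)) := by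
      ext n
      simp [hcount n]
    rw [hsum, Finset.mul_sum]
    have : ∀ B ∈ 𝓑, (1 - PowerSeries.X ^ q) ^ (d + 1) * PowerSeries.mk (fun n =>
        (latticeCount (halfOpenBox v B (s B) ∅) n : ℤ)) =
        PowerSeries.mk (fun n => (latticeCount (halfOpenBox v B (s B) B) n : ℤ)) := fun B hB => by
      rw [← hcard B hB]
      exact halfOpenBox_series w hq (h𝓑 B hB) (s B) B subset_rfl
    rw [Finset.sum_congr rfl this, ← hf]
    ext n
    rw [PowerSeries.coeff_mk, PowerSeries.coeff_trunc]
    split_ifs with hn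
    · rfl
    · rw [hcoeff]
      refine Finset.sum_eq_zero fun B hB => ?_
      rw [latticeCount_halfOpenBox_eq_zero w (h𝓑 B hB) (s B)
        (by rw [hcard B hB]; omega), Nat.cast_zero]

end Counting

section Polytope

lemma mem_convexHull_range_iff {ι F : Type*} [Fintype ι] [AddCommGroup F] [Module ℝ F]
    (u : ι → F) (x : F) : x ∈ convexHull ℝ (Set.range u) ↔
      ∃ l : ι → ℝ, (∀ i, 0 ≤ l i) ∧ ∑ i, l i = 1 ∧ ∑ i, l i • u i = x := by
  classical
  constructor
  · intro hx
    rw [convexHull_range_eq_exists_affineCombination] at hx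
    obtain ⟨s, l, hl, hl1, hlx⟩ := hx
    rw [Finset.affineCombination_eq_linear_combination _ _ _ hl1] at hlx
    refine ⟨fun i => if i ∈ s then l i else 0, fun i => ?_, ?_, ?_⟩
    · dsimp only
      split_ifs with hi
      exacts [hl i hi, le_rfl]
    · simpa using hl1
    · simpa [ite_smul] using hlx
  · rintro ⟨l, hl, hl1, rfl⟩
    exact (convex_convexHull ℝ _).sum_mem (fun i _ => hl i) hl1
      fun i _ => subset_convexHull ℝ _ ⟨i, rfl⟩

variable {d m q : ℕ} {w : Fin m → Fin d → ℤ} {P : Set (Fin d → ℝ)}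

lemma sum_smul_latticePoint_eq_iff (l : Fin m → ℝ) (x : Fin d → ℝ) (r : ℝ) :
    ∑ i, l i • latticePoint (w i) q = (x, r) ↔
      ∑ i, l i • (fun k => (w i k : ℝ)) = x ∧ ∑ i, l i * (q : ℝ) = r := by
  rw [Prod.ext_iff, Prod.fst_sum, Prod.snd_sum]
  rfl

lemma mem_cone_iff (hq : 0 < q) (hP : P.Nonempty)
    (hqP : (q : ℝ) • P = convexHull ℝ (Set.range fun i k => (w i k : ℝ)))
    (x : Fin d → ℝ) (n : ℕ) :
    (x, (n : ℝ)) ∈ cone (fun i => latticePoint (w i) q) ↔ x ∈ (n : ℝ) • P := by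
  have hq' : (0 : ℝ) < q := by exact_mod_cast hq
  have hmemP : ∀ p, p ∈ P ↔ ∃ l : Fin m → ℝ, (∀ i, 0 ≤ l i) ∧ ∑ i, l i = 1 ∧
      ∑ i, l i • (fun k => (w i k : ℝ)) = (q : ℝ) • p := fun p => by
    rw [← mem_convexHull_range_iff, ← hqP, Set.smul_mem_smul_set_iff₀ hq'.ne']
  constructor
  · rintro ⟨l, hl, hlx⟩
    obtain ⟨hx, hn⟩ := (sum_smul_latticePoint_eq_iff l x n).1 hlx
    rcases Nat.eq_zero_or_pos n with rfl | hn0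
    · have hl0 : ∀ i, l i = 0 := fun i => by
        rw [Nat.cast_zero, Finset.sum_eq_zero_iff_of_nonneg
          (fun i _ => mul_nonneg (hl i) hq'.le)] at hn
        simpa [hq'.ne'] using hn i (Finset.mem_univ i)
      obtain ⟨p, hp⟩ := hP
      exact ⟨p, hp, by simp [← hx, hl0]⟩
    · have hn' : (0 : ℝ) < n := by exact_mod_cast hn0
      refine ⟨(n : ℝ)⁻¹ • x, (hmemP _).2 ⟨fun i => (q / n : ℝ) * l i, fun i =>
        mul_nonneg (by positivity) (hl i), ?_, ?_⟩, by simp [smul_smul, hn'.ne']⟩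
      · rw [← Finset.mul_sum]
        rw [← Finset.sum_mul] at hn
        rw [div_mul_eq_mul_div, mul_comm, hn, div_self hn'.ne']
      · simp_rw [mul_smul]
        rw [← Finset.smul_sum, hx, smul_smul, div_eq_mul_inv]
  · rintro ⟨p, hp, rfl⟩
    obtain ⟨l, hl, hl1, hlp⟩ := (hmemP p).1 hp
    refine ⟨fun i => (n / q : ℝ) * l i, fun i => mul_nonneg (by positivity) (hl i), ?_⟩
    rw [sum_smul_latticePoint_eq_iff]
    constructor
    · simp_rw [mul_smul]
      rw [← Finset.smul_sum, hlp, smul_smul, div_mul_cancel₀ _ hq'.ne']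
    · rw [← Finset.sum_mul, ← Finset.mul_sum, hl1, mul_one, div_mul_cancel₀ _ hq'.ne']

lemma span_latticePoint_eq_top (hq : 0 < q) (hP : P.Nonempty) (hfull : affineSpan ℝ P = ⊤)
    (hqP : (q : ℝ) • P = convexHull ℝ (Set.range fun i k => (w i k : ℝ))) :
    Submodule.span ℝ (Set.range fun i => latticePoint (w i) q) = ⊤ := by
  set U := Submodule.span ℝ (Set.range fun i => latticePoint (w i) q) with hU
  let g : (Fin d → ℝ) →ᵃ[ℝ] (Fin d → ℝ) × ℝ :=
    (AffineMap.id ℝ (Fin d → ℝ)).prod (AffineMap.const ℝ (Fin d → ℝ) (1 : ℝ))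
  have hg : ∀ p, g p = (p, 1) := fun p => rfl
  have hle : affineSpan ℝ P ≤ U.toAffineSubspace.comap g := by
    rw [affineSpan_le]
    intro p hp
    have : (p, ((1 : ℕ) : ℝ)) ∈ cone fun i => latticePoint (w i) q := by
      rw [mem_cone_iff hq hP hqP]
      simpa using hp
    obtain ⟨l, -, hl⟩ := this
    change g p ∈ U
    rw [hg, ← Nat.cast_one (R := ℝ), ← hl]
    exact Submodule.sum_mem _ fun i _ => Submodule.smul_mem _ _ (Submodule.subset_span ⟨i, rfl⟩)
  have hmem : ∀ p : Fin d → ℝ, (p, (1 : ℝ)) ∈ U := fun p => by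
    have : p ∈ U.toAffineSubspace.comap g := hle (by rw [hfull]; trivial)
    exact this
  rw [eq_top_iff]
  rintro ⟨p, r⟩ -
  have : ((p, r) : (Fin d → ℝ) × ℝ) = ((p, (1 : ℝ)) - (0, 1)) + r • (0, 1) := by
    ext <;> simp
  rw [this]
  exact U.add_mem (U.sub_mem (hmem p) (hmem 0)) (U.smul_mem r (hmem 0))

end Polytope

end EhrhartCone

open scoped Pointwise

/-- for a full-dimensional rational polytope `P ⊆ ℝ^d` with
denominator `q`, the Ehrhart series satisfies
`(1 − t^q)^{d+1} · ∑_{n≥0} |nP ∩ ℤ^d| tⁿ = h*(t)` for a polynomial `h*` with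
nonnegative integer coefficients. -/
theorem rational_polytope_hstar_nonneg
    {d : ℕ} (P : Set (Fin d → ℝ))
    (hP : ∃ V : Finset (Fin d → ℚ),
      P = convexHull ℝ ((fun (x : Fin d → ℚ) => (fun i => (x i : ℝ))) '' (V : Set (Fin d → ℚ))))
    (hfull : affineSpan ℝ P = ⊤)
    (q : ℕ) (hq : 0 < q)
    (hqP : ∃ W : Finset (Fin d → ℤ),
      (q : ℝ) • P = convexHull ℝ ((fun (w : Fin d → ℤ) => (fun i => (w i : ℝ))) '' (W : Set (Fin d → ℤ)))) :
    ∃ h : Polynomial ℤ, (∀ i, 0 ≤ h.coeff i) ∧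
      (1 - PowerSeries.X ^ q) ^ (d + 1) *
        PowerSeries.mk (fun n =>
          (Nat.card {α : Fin d → ℤ // (fun i => (α i : ℝ)) ∈ (n : ℝ) • P} : ℤ))
      = PowerSeries.mk (fun n => h.coeff n) := by
  classical
  obtain ⟨W, hW⟩ := hqP
  have hne : P.Nonempty := by
    rw [← affineSpan_nonempty ℝ, hfull]
    exact Set.univ_nonempty
  set w : Fin W.card → Fin d → ℤ := fun i => (W.equivFin.symm i : Fin d → ℤ) with hw
  have hrange : Set.range (fun i k => (w i k : ℝ)) =
      (fun (w : Fin d → ℤ) => (fun i => (w i : ℝ))) '' (W : Set (Fin d → ℤ)) := by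
    have hwW : Set.range w = (W : Set (Fin d → ℤ)) := by
      rw [hw, ← Function.comp_def, W.equivFin.symm.surjective.range_comp]
      simp
    rw [← hwW, ← Set.range_comp]
    rfl
  rw [← hrange] at hW
  obtain ⟨h, hh0, hh⟩ := EhrhartCone.cone_series (w := w) hq
    (EhrhartCone.span_latticePoint_eq_top hq hne hfull hW)
  refine ⟨h, hh0, ?_⟩
  rw [← hh]
  congr 2
  ext n
  rw [EhrhartCone.latticeCount, ← Nat.card_coe_set_eq]
  exact congrArg Nat.cast (Nat.card_congr (Equiv.subtypeEquivRight fun α =>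
    (EhrhartCone.mem_cone_iff hq hne hW _ n).symm))
end
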